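/- arXiv:2508.09739 — 2 statements merged into one kernel-verified Lean document; each statement's English description precedes it below -/
import Mathlib

section
/- Let p be an odd prime, let ℓ be any prime, and let F be a finite extension of the field ℚ_ℓ of ℓ-adic numbers containing a primitive p²-th root of unity. Then every continuous homomorphism Gal(F_s/F) → U_3(𝔽_p) admits a lift to a continuous homomorphism Gal(F_s/F) → U_3(ℤ/p²), and every continuous homomorphism Gal(F_s/F) → GL_3(𝔽_p) admits a lift to a continuous homomorphism Gal(F_s/F) → GL_3(ℤ/p²), along the reduction ℤ/p² → ℤ/p. -/
open scoped MatrixGroups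

/-- The absolute Galois group `Gal(F_s/F)`, with its Krull topology. -/
abbrev AbsGal (F : Type) [Field F] : Type :=
  SeparableClosure F ≃ₐ[F] SeparableClosure F

/-- A matrix in `GL_d(R)` is upper triangular (i.e. lies in the Borel `B_d(R)`). -/
def IsUpperTri {d : ℕ} {R : Type} [CommRing R] (g : GL (Fin d) R) : Prop :=
  ∀ i j : Fin d, j < i → (g : Matrix (Fin d) (Fin d) R) i j = 0

/-- A matrix in `GL_d(R)` is upper unitriangular (i.e. lies in `U_d(R)`). -/
def IsUniTri {d : ℕ} {R : Type} [CommRing R] (g : GL (Fin d) R) : Prop :=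
  IsUpperTri g ∧ ∀ i : Fin d, (g : Matrix (Fin d) (Fin d) R) i i = 1

section LocalLifting

open Filter Topology

theorem Subgroup.index_eq_relIndex_map_range_mul_relIndex_ker {A B : Type*} [CommGroup A]
    [Group B] (f : A →* B) (W : Subgroup A) :
    W.index = (W.map f).relIndex f.range * W.relIndex f.ker := by
  have h1 : (W.map f).relIndex f.range = (W ⊔ f.ker).index := by
    rw [MonoidHom.range_eq_map, Subgroup.relIndex_map_map]
    simp
  have h2 : W.relIndex f.ker = W.relIndex (W ⊔ f.ker) := by
    rw [Subgroup.relIndex_sup_left]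
  rw [h1, h2, mul_comm, Subgroup.relIndex_mul_index le_sup_left]

/-- Invariance of the Herbrand quotient under passing to a subgroup of finite index, when the
cohomology group `ker g / range f` vanishes on the group and on the subgroup. -/
theorem Subgroup.relIndex_range_ker_of_finiteIndex {A : Type*} [CommGroup A] (f g : A →* A)
    (W : Subgroup A) (hW : W.index ≠ 0) (hgf : g.range ≤ f.ker) (hker : g.ker = f.range)
    (hfW : W.map f ≤ W) (hgW : W.map g ≤ W) (hkerW : g.ker ⊓ W ≤ W.map f) :
    g.range.relIndex f.ker = (W.map g).relIndex (f.ker ⊓ W) := by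
  have e1 := Subgroup.index_eq_relIndex_map_range_mul_relIndex_ker f W
  have e2 := Subgroup.index_eq_relIndex_map_range_mul_relIndex_ker g W
  have e3 : W.relIndex g.ker = (W.map f).relIndex f.range := by
    have : g.ker ⊓ W = W.map f :=
      le_antisymm hkerW (le_inf (hker ▸ Subgroup.map_le_range f W) hfW)
    rw [← Subgroup.inf_relIndex_left, this, hker]
  have e4 : (W.map g).relIndex g.range * g.range.relIndex f.ker = (W.map g).relIndex f.ker :=
    Subgroup.relIndex_mul_relIndex _ _ _ (Subgroup.map_le_range g W) hgf
  have e5 : (W.map g).relIndex (f.ker ⊓ W) * W.relIndex f.ker = (W.map g).relIndex f.ker := by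
    rw [← Subgroup.inf_relIndex_left f.ker W]
    exact Subgroup.relIndex_mul_relIndex _ _ _
      (le_inf ((Subgroup.map_le_range g W).trans hgf) hgW) inf_le_left
  have hb : (W.map f).relIndex f.range ≠ 0 := fun h => hW (by rw [e1, h, zero_mul])
  have ha : (W.map g).relIndex g.range ≠ 0 := fun h => hW (by rw [e2, h, zero_mul])
  have had : (W.map g).relIndex g.range = W.relIndex f.ker := by
    have : (W.map f).relIndex f.range * (W.map g).relIndex g.range
        = (W.map f).relIndex f.range * W.relIndex f.ker := by
      rw [← e1, e2, e3, mul_comm]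
    exact Nat.eq_of_mul_eq_mul_left (Nat.pos_of_ne_zero hb) this
  have : (W.map g).relIndex g.range * g.range.relIndex f.ker
      = (W.map g).relIndex g.range * (W.map g).relIndex (f.ker ⊓ W) := by
    rw [e4, ← e5, had, mul_comm]
  exact Nat.eq_of_mul_eq_mul_left (Nat.pos_of_ne_zero ha) this

section Cyclic

variable {M : Type*} [Field M]

/-- The endomorphism `x ↦ σ x / x` of the unit group. -/
noncomputable def autDiv (σ : M ≃+* M) : Mˣ →* Mˣ :=
  Units.map (σ : M →* M) / MonoidHom.id Mˣ

/-- The endomorphism `x ↦ x * σ x * ⋯ * σ ^ (n - 1) x` of the unit group. -/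
noncomputable def cycNorm (σ : M ≃+* M) (n : ℕ) : Mˣ →* Mˣ :=
  ∏ i ∈ Finset.range n, Units.map ((σ ^ i : M ≃+* M) : M →* M)

theorem coe_autDiv (σ : M ≃+* M) (x : Mˣ) : (autDiv σ x : M) = σ x / x := by
  simp [autDiv]

theorem coe_cycNorm (σ : M ≃+* M) (n : ℕ) (x : Mˣ) :
    (cycNorm σ n x : M) = ∏ i ∈ Finset.range n, (σ ^ i) (x : M) := by
  simp [cycNorm, MonoidHom.finsetProd_apply]

theorem mem_ker_autDiv {σ : M ≃+* M} {x : Mˣ} : x ∈ (autDiv σ).ker ↔ σ (x : M) = x := by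
  rw [MonoidHom.mem_ker, Units.ext_iff, coe_autDiv, Units.val_one, div_eq_one_iff_eq x.ne_zero]

theorem map_cycNorm (σ : M ≃+* M) {n : ℕ} (hσ : σ ^ n = 1) (x : Mˣ) :
    σ (cycNorm σ n x : M) = cycNorm σ n x := by
  rw [coe_cycNorm, map_prod]
  have h1 := Finset.prod_range_succ (fun i => (σ ^ i) (x : M)) n
  have h2 := Finset.prod_range_succ' (fun i => (σ ^ i) (x : M)) n
  rw [h1, hσ] at h2
  simp only [RingAut.one_apply, pow_zero] at h2
  have := mul_right_cancel₀ x.ne_zero h2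
  rw [this]
  exact Finset.prod_congr rfl fun i _ => by rw [pow_succ', RingAut.mul_apply]

theorem cycNorm_autDiv (σ : M ≃+* M) {n : ℕ} (hσ : σ ^ n = 1) (x : Mˣ) :
    cycNorm σ n (autDiv σ x) = 1 := by
  ext
  rw [coe_cycNorm, Units.val_one]
  have : ∀ m, ∏ i ∈ Finset.range m, (σ ^ i) (autDiv σ x : M) = (σ ^ m) x / x := by
    intro m
    induction m with
    | zero => simp
    | succ m ih =>
      rw [Finset.prod_range_succ, ih, coe_autDiv, map_div₀, ← RingAut.mul_apply, ← pow_succ]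
      have : (σ ^ m) (x : M) ≠ 0 := (map_ne_zero _).2 x.ne_zero
      have := x.ne_zero
      field_simp
  rw [this, hσ]
  simp

/-- Hilbert's Theorem 90 for a cyclic group of field automorphisms. -/
theorem mem_range_autDiv_of_cycNorm_eq_one (σ : M ≃+* M) {n : ℕ} (hσ : orderOf σ = n)
    (hn : n ≠ 0) (z : Mˣ) (hz : cycNorm σ n z = 1) : z ∈ (autDiv σ).range := by
  let c : ℕ → M := fun i => ∏ j ∈ Finset.range i, (σ ^ j) (z : M)
  have hc : ∀ i, c (i + 1) = z * σ (c i) := by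
    intro i
    simp only [c]
    rw [Finset.prod_range_succ', map_prod, mul_comm]
    simp [pow_succ', RingAut.mul_apply]
  have hcn : c n = 1 := by
    have := congrArg Units.val hz
    rwa [coe_cycNorm] at this
  have hne : ∃ x : M, ∑ i ∈ Finset.range n, c i * (σ ^ i) x ≠ 0 := by
    by_contra! h
    have hli := linearIndependent_monoidHom M M
    have hinj : Function.Injective (fun i : Fin n => ((σ ^ (i : ℕ) : M ≃+* M) : M →* M)) := by
      intro i j hij
      have : σ ^ (i : ℕ) = σ ^ (j : ℕ) := by
        ext x
        exact DFunLike.congr_fun hij x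
      exact Fin.ext (pow_injOn_Iio_orderOf (by simp [hσ]) (by simp [hσ]) this)
    have := (Fintype.linearIndependent_iff.1 (hli.comp _ hinj)) (fun i => c i) (by
      ext x
      have := h x
      rw [Finset.sum_range] at this
      simpa using this) ⟨0, Nat.pos_of_ne_zero hn⟩
    simp [c] at this
  obtain ⟨x, hx⟩ := hne
  set w := ∑ i ∈ Finset.range n, c i * (σ ^ i) x with hw
  have key : (z : M) * σ w = w := by
    have h1 := Finset.sum_range_succ (fun i => c i * (σ ^ i) x) n
    have h2 := Finset.sum_range_succ' (fun i => c i * (σ ^ i) x) n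
    rw [h1, ← hσ, pow_orderOf_eq_one, hσ, hcn] at h2
    simp only [c, Finset.range_zero, Finset.prod_empty, pow_zero, RingAut.one_apply] at h2
    have h3 := add_right_cancel h2
    rw [hw]
    change (z : M) * σ w = ∑ i ∈ Finset.range n, c i * (σ ^ i) x
    refine Eq.trans ?_ h3.symm
    rw [hw, map_sum, Finset.mul_sum]
    refine Finset.sum_congr rfl fun i _ => ?_
    change _ = c (i + 1) * _
    rw [hc, pow_succ', RingAut.mul_apply, map_mul, mul_assoc]
  refine ⟨(Units.mk0 w hx)⁻¹, ?_⟩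
  ext
  rw [coe_autDiv, Units.val_inv_eq_inv_val, map_inv₀, Units.val_mk0]
  have : σ w ≠ 0 := by simpa using hx
  field_simp
  rw [mul_comm, key]

end Cyclic

section PadicExp

variable (l : ℕ) [Fact l.Prime] {L : Type*} [NormedField L] [NormedAlgebra ℚ_[l] L]

theorem norm_inv_factorial_le (k : ℕ) : ‖((k.factorial : ℚ_[l]))⁻¹‖ ≤ (l : ℝ) ^ k := by
  have hl : (1 : ℝ) ≤ l := by exact_mod_cast (Fact.out : l.Prime).one_le
  rw [norm_inv, Padic.norm_eq_zpow_neg_valuation (by exact_mod_cast Nat.factorial_ne_zero k),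
    zpow_neg, inv_inv, Padic.valuation_natCast, zpow_natCast]
  refine pow_le_pow_right₀ hl ?_
  have h := sub_one_mul_padicValNat_factorial (p := l) k
  have h2 : 1 ≤ l - 1 := by have := (Fact.out : l.Prime).two_le; omega
  calc padicValNat l k.factorial ≤ (l - 1) * padicValNat l k.factorial := by nlinarith
    _ ≤ k := by rw [h]; omega

theorem expSeries_radius_pos_padic : 0 < (NormedSpace.expSeries ℚ_[l] L).radius := by
  have hl : (0 : ℝ) < l := by exact_mod_cast (Fact.out : l.Prime).pos
  have : ((l : NNReal)⁻¹ : NNReal) ≤ (NormedSpace.expSeries ℚ_[l] L).radius := by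
    refine FormalMultilinearSeries.le_radius_of_bound _ 1 fun k => ?_
    rw [NormedSpace.expSeries, norm_smul, ContinuousMultilinearMap.norm_mkPiAlgebraFin, mul_one]
    calc _ ≤ (l : ℝ) ^ k * ((l : ℝ)⁻¹) ^ k := by
          gcongr
          · exact norm_inv_factorial_le l k
          · simp
      _ = 1 := by rw [← mul_pow, mul_inv_cancel₀ hl.ne', one_pow]
  refine lt_of_lt_of_le ?_ this
  simp

theorem exists_exp_ball [FiniteDimensional ℚ_[l] L] [IsUltrametricDist L] :
    ∃ δ : ℝ, 0 < δ ∧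
      (∀ x y : L, ‖x‖ < δ → ‖y‖ < δ →
        NormedSpace.exp (x + y) = NormedSpace.exp x * NormedSpace.exp y) ∧
      (∀ x : L, ‖x‖ < δ → NormedSpace.exp x = 1 → x = 0) ∧
      (∀ x : L, ‖x‖ < δ → ‖NormedSpace.exp x‖ = 1) ∧
      (∀ (σ : L ≃ₐ[ℚ_[l]] L) (x : L), ‖x‖ < δ →
        σ (NormedSpace.exp x) = NormedSpace.exp (σ x)) ∧
      map (NormedSpace.exp : L → L) (𝓝 0) = 𝓝 1 := by
  have hc : CompleteSpace L := FiniteDimensional.complete ℚ_[l] L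
  have hr := expSeries_radius_pos_padic l (L := L)
  have hd := hasStrictFDerivAt_exp_zero_of_radius_pos hr
  have hd' : HasStrictFDerivAt (NormedSpace.exp : L → L)
    ((ContinuousLinearEquiv.refl ℚ_[l] L : L ≃L[ℚ_[l]] L) : L →L[ℚ_[l]] L) 0 := hd
  have hmap := hd'.map_nhds_eq_of_equiv
  rw [NormedSpace.exp_zero] at hmap
  have hball : Metric.eball (0 : L) (NormedSpace.expSeries ℚ_[l] L).radius ∈ 𝓝 (0 : L) :=
    Metric.eball_mem_nhds _ hr
  have hleft := hd'.eventually_left_inverse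
  have hcont : Tendsto (NormedSpace.exp : L → L) (𝓝 0) (𝓝 1) := hmap.le
  have hnorm : ∀ᶠ x in 𝓝 (0 : L), NormedSpace.exp x ∈ Metric.ball (1 : L) 1 :=
    hcont (Metric.ball_mem_nhds _ one_pos)
  obtain ⟨δ, hδ, h⟩ := Metric.mem_nhds_iff.1 (inter_mem hball (inter_mem hleft hnorm))
  have h' : ∀ x : L, ‖x‖ < δ → _ := fun x hx => h (by simpa using hx)
  refine ⟨δ, hδ, fun x y hx hy => ?_, fun x hx h1 => ?_, fun x hx => ?_, fun σ x hx => ?_, hmap⟩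
  · exact NormedSpace.exp_add_of_mem_ball (h' x hx).1 (h' y hy).1
  · have h2 := (h' x hx).2.1
    have h3 := (h' 0 (by simpa using hδ)).2.1
    simp only [Set.mem_ofPred_eq] at h2 h3
    rw [h1] at h2
    rw [NormedSpace.exp_zero] at h3
    rw [← h2, h3]
  · have h2 := (h' x hx).2.2
    simp only [Set.mem_ofPred_eq, Metric.mem_ball, dist_eq_norm] at h2
    have : NormedSpace.exp x = 1 + (NormedSpace.exp x - 1) := by ring
    rw [this, IsUltrametricDist.norm_add_eq_max_of_norm_ne_norm, norm_one, max_eq_left h2.le]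
    rw [norm_one]
    exact h2.ne'
  · exact NormedSpace.map_exp_of_mem_ball σ
      (LinearMap.continuous_of_finiteDimensional σ.toLinearMap) x (h' x hx).1

end PadicExp

section Lattice

variable (l : ℕ) [Fact l.Prime] {L : Type*} [NormedField L] [NormedAlgebra ℚ_[l] L]
  [FiniteDimensional ℚ_[l] L] [IsUltrametricDist L]

/-- Small open lattices that are cohomologically trivial for a cyclic group of automorphisms,
built from a normal basis. -/
theorem exists_cohomologicallyTrivial_lattice (σ : L ≃ₐ[ℚ_[l]] L) {δ : ℝ} (hδ : 0 < δ) :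
    ∃ Λ : AddSubgroup L, (Λ : Set L) ∈ 𝓝 0 ∧ (∀ x ∈ Λ, ‖x‖ < δ) ∧ (∀ x ∈ Λ, σ x ∈ Λ) ∧
      (∀ x ∈ Λ, σ x = x → ∃ y ∈ Λ, ∑ i ∈ Finset.range (orderOf σ), (σ ^ i) y = x) ∧
      (∀ x ∈ Λ, ∑ i ∈ Finset.range (orderOf σ), (σ ^ i) x = 0 → ∃ y ∈ Λ, σ y - y = x) := by
  classical
  let G := Subgroup.zpowers σ
  let K := IntermediateField.fixedField (F := ℚ_[l]) (E := L) G
  have : IsGalois K L := IsGalois.of_fixed_field L G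
  let e := IntermediateField.subgroupEquivAlgEquiv (F := ℚ_[l]) (E := L) G
  let τ : Gal(L/K) := e ⟨σ, Subgroup.mem_zpowers σ⟩
  have hτ : ∀ x, τ x = σ x := fun x => rfl
  have hτpow : ∀ (i : ℕ) x, (τ ^ i) x = (σ ^ i) x := by
    intro i
    induction i with
    | zero => simp
    | succ i ih => intro x; rw [pow_succ', pow_succ', AlgEquiv.mul_apply, AlgEquiv.mul_apply, ih, hτ]
  have hord : orderOf τ = orderOf σ := by
    rw [← Subgroup.orderOf_mk σ (Subgroup.mem_zpowers σ)]
    exact MulEquiv.orderOf_eq e _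
  have hgen : ∀ g : Gal(L/K), ∃ i : ℕ, τ ^ i = g := by
    intro g
    obtain ⟨⟨s, hs⟩, rfl⟩ := e.surjective g
    obtain ⟨i, rfl⟩ := (mem_powers_iff_mem_zpowers (x := σ)).2 hs
    exact ⟨i, by rw [← map_pow]; rfl⟩
  have hsum : ∀ f : Gal(L/K) → L, ∑ i ∈ Finset.range (orderOf σ), f (τ ^ i) = ∑ g, f g := by
    intro f
    rw [← hord]
    refine Finset.sum_bij (fun i _ => τ ^ i) (fun _ _ => Finset.mem_univ _) ?_ ?_ ?_
    · intro i hi j hj h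
      exact pow_injOn_Iio_orderOf (by simpa using hi) (by simpa using hj) h
    · intro g _
      obtain ⟨i, rfl⟩ := hgen g
      exact ⟨i % orderOf τ, by simpa using Nat.mod_lt _ (orderOf_pos τ), pow_mod_orderOf _ _⟩
    · intros; rfl
  let b := IsGalois.normalBasis K L
  have hb : ∀ g h : Gal(L/K), g (b h) = b (g * h) := by
    intro g h
    rw [IsGalois.normalBasis_apply h, IsGalois.normalBasis_apply (g * h), AlgEquiv.mul_apply]
  have hgx : ∀ (g : Gal(L/K)) (c : Gal(L/K) → K), g (∑ h, c h • b h) = ∑ h, c (g⁻¹ * h) • b h := by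
    intro g c
    rw [map_sum, ← Equiv.sum_comp (Equiv.mulLeft g) (fun h => c (g⁻¹ * h) • b h)]
    refine Finset.sum_congr rfl fun h _ => ?_
    simp [hb]
  obtain ⟨r, hr0, hr⟩ : ∃ r : ℝ, 0 < r ∧ r * (∑ g, ‖b g‖) < δ := by
    have h0 : 0 ≤ ∑ g, ‖b g‖ := Finset.sum_nonneg fun _ _ => norm_nonneg _
    refine ⟨δ / (∑ g, ‖b g‖ + 1), by positivity, ?_⟩
    rw [div_mul_eq_mul_div, div_lt_iff₀ (by positivity)]
    nlinarith
  let Λ : AddSubgroup L :=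
    { carrier := {x | ∃ c : Gal(L/K) → K, (∀ g, ‖(c g : L)‖ ≤ r) ∧ x = ∑ g, c g • b g}
      zero_mem' := ⟨0, by simp [hr0.le], by simp⟩
      add_mem' := by
        rintro _ _ ⟨c, hc, rfl⟩ ⟨d, hd, rfl⟩
        refine ⟨c + d, fun g => ?_, by simp [add_smul, Finset.sum_add_distrib]⟩
        exact (IsUltrametricDist.norm_add_le_max _ _).trans (max_le (hc g) (hd g))
      neg_mem' := by
        rintro _ ⟨c, hc, rfl⟩
        exact ⟨-c, fun g => by simpa using hc g, by simp⟩ }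
  have hτΛ : ∀ (g : Gal(L/K)), ∀ x ∈ Λ, g x ∈ Λ := by
    rintro g _ ⟨c, hc, rfl⟩
    exact ⟨_, fun h => hc _, hgx g c⟩
  have hsingle : ∀ (k : K) (g : Gal(L/K)), ‖(k : L)‖ ≤ r → k • b g ∈ Λ := by
    intro k g hk
    refine ⟨Pi.single g k, fun h => ?_, ?_⟩
    · by_cases hh : h = g
      · subst hh; simpa using hk
      · simp [Pi.single_eq_of_ne hh, hr0.le]
    · rw [Finset.sum_eq_single g] <;> simp +contextual [Pi.single_eq_of_ne]
  refine ⟨Λ, ?_, ?_, fun x hx => hτΛ τ x hx, ?_, ?_⟩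
  · have hcont : ∀ g, Continuous fun x : L => ((b.repr x g : K) : L) := by
      intro g
      exact LinearMap.continuous_of_finiteDimensional
        (((Algebra.linearMap K L) ∘ₗ (b.coord g)).restrictScalars ℚ_[l])
    have hev : ∀ g, ∀ᶠ x : L in 𝓝 0, ‖((b.repr x g : K) : L)‖ < r := by
      intro g
      have := (hcont g).norm.tendsto 0
      simp only [map_zero, Finsupp.coe_zero, Pi.zero_apply, ZeroMemClass.coe_zero,
        norm_zero] at this
      exact this.eventually_lt_const hr0
    filter_upwards [eventually_all.2 hev] with x hx
    exact ⟨fun g => b.repr x g, fun g => (hx g).le, (b.sum_repr x).symm⟩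
  · rintro _ ⟨c, hc, rfl⟩
    refine lt_of_le_of_lt (norm_sum_le _ _) (lt_of_le_of_lt ?_ hr)
    rw [Finset.mul_sum]
    refine Finset.sum_le_sum fun g _ => ?_
    rw [Algebra.smul_def, norm_mul]
    exact mul_le_mul_of_nonneg_right (hc g) (norm_nonneg _)
  · rintro _ ⟨c, hc, rfl⟩ hfix
    rw [← hτ, hgx] at hfix
    have h1 : ∀ h, c (τ⁻¹ * h) = c h := by
      have := b.repr.congr_arg hfix
      intro h
      have := DFunLike.congr_fun this h
      rwa [b.repr_sum_self, b.repr_sum_self] at this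
    have h2 : ∀ i : ℕ, c (τ ^ i) = c 1 := by
      intro i
      induction i with
      | zero => simp
      | succ i ih => rw [← h1, pow_succ', inv_mul_cancel_left, ih]
    refine ⟨c 1 • b 1, hsingle _ _ (hc 1), ?_⟩
    simp_rw [← hτpow]
    rw [hsum (fun g => g (c 1 • b 1))]
    refine Finset.sum_congr rfl fun g _ => ?_
    obtain ⟨i, rfl⟩ := hgen g
    rw [map_smul, hb, mul_one, h2]
  · rintro _ ⟨c, hc, rfl⟩ htr
    simp_rw [← hτpow] at htr
    rw [hsum (fun g => g (∑ h, c h • b h))] at htr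
    have h1 : ∑ g, c g = 0 := by
      have h2 : ∑ g : Gal(L/K), g (∑ h, c h • b h) = ∑ h, (∑ g, c g) • b h := by
        simp_rw [hgx]
        rw [Finset.sum_comm]
        refine Finset.sum_congr rfl fun h _ => ?_
        rw [← Finset.sum_smul]
        congr 1
        exact Fintype.sum_equiv ((Equiv.inv _).trans (Equiv.mulRight h)) _ _ (fun g => by simp)
      rw [h2] at htr
      have := DFunLike.congr_fun (b.repr.congr_arg htr) 1
      rwa [b.repr_sum_self, map_zero] at this
    choose i hi using hgen
    refine ⟨∑ g, ∑ j ∈ Finset.range (i g), (τ ^ j) (c g • b 1), ?_, ?_⟩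
    · exact sum_mem fun g _ => sum_mem fun j _ => hτΛ _ _ (hsingle _ _ (hc g))
    · rw [← hτ, map_sum, ← Finset.sum_sub_distrib]
      have h3 : ∀ g : Gal(L/K), τ (∑ j ∈ Finset.range (i g), (τ ^ j) (c g • b 1))
          - ∑ j ∈ Finset.range (i g), (τ ^ j) (c g • b 1) = c g • b g - c g • b 1 := by
        intro g
        rw [map_sum, ← Finset.sum_sub_distrib]
        have : ∀ j, τ ((τ ^ j) (c g • b 1)) = (τ ^ (j + 1)) (c g • b 1) := fun j => by
          rw [pow_succ', AlgEquiv.mul_apply]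
        simp_rw [this]
        rw [Finset.sum_range_sub (fun j => (τ ^ j) (c g • b 1)), hi, map_smul, hb, mul_one,
          pow_zero, AlgEquiv.one_apply]
      simp_rw [h3]
      rw [Finset.sum_sub_distrib, ← Finset.sum_smul, h1, zero_smul, sub_zero]

end Lattice

section NormIndex

variable (l : ℕ) [Fact l.Prime] {L : Type*}

theorem subgroup_index_ne_zero_of_nhds [NormedField L] [NormedAlgebra ℚ_[l] L]
    [FiniteDimensional ℚ_[l] L] (W : Subgroup Lˣ) (ϖ : Lˣ) (hϖ : ϖ ∈ W) (hϖ1 : 1 < ‖(ϖ : L)‖)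
    (hW : (Units.val '' (W : Set Lˣ)) ∈ 𝓝 (1 : L)) : W.index ≠ 0 := by
  have hproper : ProperSpace L := FiniteDimensional.proper ℚ_[l] L
  let C : Set L := {x | 1 ≤ ‖x‖ ∧ ‖x‖ ≤ ‖(ϖ : L)‖}
  have hC : IsCompact C := by
    refine (isCompact_closedBall (0 : L) ‖(ϖ : L)‖).of_isClosed_subset ?_ fun x hx => ?_
    · exact (isClosed_le continuous_const continuous_norm).inter
        (isClosed_le continuous_norm continuous_const)
    · simpa using hx.2
  have hnhd : ∀ x ∈ C, (fun w => x * w) '' (Units.val '' (W : Set Lˣ)) ∈ 𝓝 x := by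
    intro x hx
    have hx0 : x ≠ 0 := norm_pos_iff.1 (lt_of_lt_of_le one_pos hx.1)
    have := (Homeomorph.mulLeft₀ x hx0).map_nhds_eq 1
    have h2 := Filter.image_mem_map (m := Homeomorph.mulLeft₀ x hx0) hW
    rw [this] at h2
    simpa using h2
  obtain ⟨t, htC, ht⟩ := hC.elim_nhds_subcover _ hnhd
  have hcov : ∀ u : Lˣ, ∃ x ∈ t, ∃ w ∈ W, ∃ k : ℤ, (u * ϖ ^ k : Lˣ) = x * (w : L) := by
    intro u
    obtain ⟨k, hk⟩ := exists_mem_Ico_zpow (x := ‖(u : L)‖) (y := ‖(ϖ : L)‖)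
      (norm_pos_iff.2 u.ne_zero) hϖ1
    have hpos : 0 < ‖(ϖ : L)‖ := one_pos.trans hϖ1
    have : ((u * ϖ ^ (-k) : Lˣ) : L) ∈ C := by
      have hk0 : 0 < ‖(ϖ : L)‖ ^ k := zpow_pos hpos k
      simp only [C, Set.mem_ofPred_eq, Units.val_mul, Units.val_zpow_eq_zpow_val, norm_mul,
        norm_zpow]
      rw [zpow_neg, ← div_eq_mul_inv, le_div_iff₀ hk0, div_le_iff₀ hk0, one_mul, mul_comm,
        ← zpow_add_one₀ hpos.ne']
      exact ⟨hk.1, hk.2.le⟩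
    obtain ⟨x, hx, hu⟩ := Set.mem_iUnion₂.1 (ht this)
    obtain ⟨_, ⟨w, hw, rfl⟩, h⟩ := hu
    exact ⟨x, hx, w, hw, -k, h.symm⟩
  choose f hft w hw k hf using hcov
  have : Finite (Lˣ ⧸ W) := by
    refine Finite.of_injective (β := t) (fun q => ⟨f q.out, hft _⟩) ?_
    intro q q' h
    have h' : f q.out = f q'.out := congrArg Subtype.val h
    rw [← QuotientGroup.out_eq' q, ← QuotientGroup.out_eq' q', QuotientGroup.eq]
    have e1 := hf q.out
    have e2 := hf q'.out
    rw [h'] at e1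
    have e3 : q.out * ϖ ^ (k q.out) * w q'.out = q'.out * ϖ ^ (k q'.out) * w q.out := by
      ext
      rw [Units.val_mul, e1, Units.val_mul, e2]
      ring
    have e4 : q.out⁻¹ * q'.out
        = ϖ ^ (k q.out) * w q'.out * (w q.out)⁻¹ * (ϖ ^ (k q'.out))⁻¹ := by
      rw [eq_mul_inv_iff_mul_eq, eq_mul_inv_iff_mul_eq, mul_assoc, mul_assoc, inv_mul_eq_iff_eq_mul,
        ← mul_assoc, ← mul_assoc, e3]
    rw [e4]
    exact W.mul_mem (W.mul_mem (W.mul_mem (W.zpow_mem hϖ _) (hw _)) (W.inv_mem (hw _)))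
      (W.inv_mem (W.zpow_mem hϖ _))
  exact Subgroup.index_ne_zero_of_finite

theorem relIndex_cycNorm_of_normed [NormedField L] [NormedAlgebra ℚ_[l] L]
    [FiniteDimensional ℚ_[l] L] [IsUltrametricDist L] (σ : L ≃ₐ[ℚ_[l]] L) :
    (cycNorm (σ : L ≃+* L) (orderOf σ)).range.relIndex (autDiv (σ : L ≃+* L)).ker = orderOf σ := by
  classical
  obtain ⟨δ, hδ, hadd, hinj, hnorm, hmap, hnhds⟩ := exists_exp_ball l (L := L)
  obtain ⟨Λ, hΛ0, hΛδ, hΛσ, hΛ1, hΛ2⟩ := exists_cohomologicallyTrivial_lattice l σ hδ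
  set n := orderOf σ with hn
  have hn0 : n ≠ 0 := (orderOf_pos σ).ne'
  set s : L ≃+* L := (σ : L ≃+* L) with hs
  have hspow : ∀ (i : ℕ) (x : L), (s ^ i) x = (σ ^ i) x := by
    intro i
    induction i with
    | zero => simp
    | succ i ih => intro x; rw [pow_succ', pow_succ', AlgEquiv.mul_apply, RingAut.mul_apply, ih]; rfl
  have hsord : orderOf s = n := by
    rw [hn]
    refine orderOf_eq_orderOf_iff.2 fun i => ?_
    constructor
    · intro h; ext x; rw [← hspow, h]; rfl
    · intro h; ext x; rw [hspow, h]; rfl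
  have hsn : s ^ n = 1 := by rw [← hsord, pow_orderOf_eq_one]
  have hl0 : (l : L) ≠ 0 := by
    have : (l : ℚ_[l]) ≠ 0 := by exact_mod_cast (Fact.out : l.Prime).ne_zero
    simpa using (map_ne_zero (algebraMap ℚ_[l] L)).2 this
  let ϖ : Lˣ := (Units.mk0 (l : L) hl0)⁻¹
  have hϖ1 : 1 < ‖(ϖ : L)‖ := by
    have h1 : ‖(l : L)‖ = (l : ℝ)⁻¹ := by
      rw [← map_natCast (algebraMap ℚ_[l] L), norm_algebraMap', Padic.norm_p]
    simp only [ϖ, Units.val_inv_eq_inv_val, Units.val_mk0, norm_inv, h1, inv_inv]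
    exact_mod_cast (Fact.out : l.Prime).one_lt
  have hϖs : autDiv s ϖ = 1 := by
    rw [← MonoidHom.mem_ker, mem_ker_autDiv]
    simp [ϖ]
  let ex : Multiplicative Λ →* Lˣ :=
    { toFun := fun x => Units.mk0 (NormedSpace.exp (x.toAdd : L)) (by
        rw [← norm_pos_iff, hnorm _ (hΛδ _ x.toAdd.2)]; exact one_pos)
      map_one' := by ext; simp [NormedSpace.exp_zero]
      map_mul' := fun x y => by
        ext
        simp only [toAdd_mul, AddSubgroup.coe_add, Units.val_mk0, Units.val_mul]
        exact hadd _ _ (hΛδ _ x.toAdd.2) (hΛδ _ y.toAdd.2) }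
  have hex : ∀ x : Λ, (ex (Multiplicative.ofAdd x) : L) = NormedSpace.exp (x : L) := fun x => rfl
  have hexinj : ∀ x : Λ, ex (Multiplicative.ofAdd x) = 1 → x = 0 := by
    intro x hx
    have := congrArg Units.val hx
    rw [hex] at this
    exact Subtype.ext (hinj _ (hΛδ _ x.2) this)
  have hexnorm : ∀ x, ‖(ex x : L)‖ = 1 := fun x => hnorm _ (hΛδ _ x.toAdd.2)
  have hpowΛ : ∀ (i : ℕ), ∀ x ∈ Λ, (σ ^ i) x ∈ Λ := by
    intro i
    induction i with
    | zero => intro x hx; exact hx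
    | succ i ih => intro x hx; rw [pow_succ', AlgEquiv.mul_apply]; exact hΛσ _ (ih x hx)
  let d : Λ → Λ := fun x => ⟨σ x - x, Λ.sub_mem (hΛσ _ x.2) x.2⟩
  let tr : Λ → Λ := fun x => ∑ i ∈ Finset.range n, ⟨(σ ^ i) x, hpowΛ i x x.2⟩
  have htr : ∀ x : Λ, (tr x : L) = ∑ i ∈ Finset.range n, (σ ^ i) (x : L) := by
    intro x; simp [tr]
  have hfex : ∀ x : Λ, autDiv s (ex (.ofAdd x)) = ex (.ofAdd (d x)) := by
    intro x
    have h1 : d x = ⟨σ x, hΛσ _ x.2⟩ - x := rfl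
    rw [h1, ofAdd_sub, map_div]
    ext
    rw [coe_autDiv, Units.val_div_eq_div_val, hex, hex]
    congr 1
    exact hmap σ _ (hΛδ _ x.2)
  have hNex : ∀ x : Λ, cycNorm s n (ex (.ofAdd x)) = ex (.ofAdd (tr x)) := by
    intro x
    rw [ofAdd_sum, map_prod]
    ext
    rw [coe_cycNorm, Units.coe_prod]
    refine Finset.prod_congr rfl fun i _ => ?_
    rw [hex, hex, hspow]
    exact hmap (σ ^ i) _ (hΛδ _ x.2)
  have hNϖ : cycNorm s n ϖ = ϖ ^ n := by
    ext
    rw [coe_cycNorm, Units.val_pow_eq_pow_val, Finset.prod_congr rfl (g := fun _ => (ϖ : L)),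
      Finset.prod_const, Finset.card_range]
    intro i _
    rw [hspow]
    simp [ϖ]
  let h : Multiplicative ℤ →* Lˣ := zpowersHom Lˣ ϖ
  have hh : ∀ k : ℤ, h (.ofAdd k) = ϖ ^ k := fun k => rfl
  let W : Subgroup Lˣ := h.range ⊔ ex.range
  have hWmem : ∀ u, u ∈ W ↔ ∃ (k : ℤ) (x : Λ), ϖ ^ k * ex (.ofAdd x) = u := by
    intro u
    rw [Subgroup.mem_sup]
    constructor
    · rintro ⟨_, ⟨k, rfl⟩, _, ⟨x, rfl⟩, rfl⟩
      exact ⟨k.toAdd, x.toAdd, rfl⟩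
    · rintro ⟨k, x, rfl⟩
      exact ⟨_, ⟨.ofAdd k, rfl⟩, _, ⟨.ofAdd x, rfl⟩, rfl⟩
  have hzero : ∀ (k : ℤ) (x : Multiplicative Λ), ϖ ^ k * ex x = 1 → k = 0 := by
    intro k x hk
    have h1 := congrArg (fun u : Lˣ => ‖(u : L)‖) hk
    simp only [Units.val_mul, norm_mul, hexnorm, mul_one, Units.val_zpow_eq_zpow_val, norm_zpow,
      Units.val_one, norm_one] at h1
    exact (zpow_eq_one_iff_right₀ (norm_nonneg _) hϖ1.ne').1 h1
  have hWindex : W.index ≠ 0 := by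
    refine subgroup_index_ne_zero_of_nhds l W ϖ ((hWmem _).2 ⟨1, 0, by simp⟩) hϖ1 ?_
    rw [← hnhds]
    refine mem_of_superset (image_mem_map hΛ0) ?_
    rintro _ ⟨x, hx, rfl⟩
    exact ⟨ex (.ofAdd ⟨x, hx⟩), (hWmem _).2 ⟨0, ⟨x, hx⟩, by simp⟩, rfl⟩
  rw [Subgroup.relIndex_range_ker_of_finiteIndex (autDiv s) (cycNorm s n) W hWindex]
  · have e1 : (autDiv s).ker ⊓ W = h.range ⊔ W.map (cycNorm s n) := by
      apply le_antisymm
      · rintro u ⟨hu, huW⟩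
        obtain ⟨k, x, rfl⟩ := (hWmem _).1 huW
        have hu' : autDiv s (ϖ ^ k * ex (.ofAdd x)) = 1 := hu
        rw [map_mul, map_zpow, hϖs, one_zpow, one_mul, hfex] at hu'
        have h2 : σ x - (x : L) = 0 := congrArg Subtype.val (hexinj _ hu')
        obtain ⟨y, hy, hyx⟩ := hΛ1 x x.2 (sub_eq_zero.1 h2)
        refine Subgroup.mul_mem_sup ⟨.ofAdd k, rfl⟩
          ⟨ex (.ofAdd ⟨y, hy⟩), (hWmem _).2 ⟨0, _, by rw [zpow_zero, one_mul]⟩, ?_⟩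
        rw [hNex]
        congr 2
        exact Subtype.ext ((htr _).trans hyx)
      · refine sup_le ?_ ?_
        · rintro _ ⟨k, rfl⟩
          refine ⟨?_, Subgroup.mem_sup_left ⟨k, rfl⟩⟩
          change autDiv s (ϖ ^ k.toAdd) = 1
          rw [map_zpow, hϖs, one_zpow]
        · rintro _ ⟨u, hu, rfl⟩
          refine ⟨mem_ker_autDiv.2 (map_cycNorm s hsn u), ?_⟩
          obtain ⟨k, x, rfl⟩ := (hWmem _).1 hu
          refine (hWmem _).2 ⟨n * k, tr x, ?_⟩
          rw [map_mul, map_zpow, hNϖ, hNex, zpow_mul, zpow_natCast]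
    rw [e1, Subgroup.relIndex_sup_right, ← Subgroup.index_comap]
    have e2 : (W.map (cycNorm s n)).comap h = AddSubgroup.toSubgroup (AddSubgroup.zmultiples (n : ℤ)) := by
      ext k
      obtain ⟨k, rfl⟩ := Multiplicative.ofAdd.surjective k
      rw [Subgroup.mem_comap, hh]
      change _ ↔ k ∈ AddSubgroup.zmultiples (n : ℤ)
      rw [Int.mem_zmultiples_iff]
      constructor
      · rintro ⟨u, hu, huk⟩
        obtain ⟨j, x, rfl⟩ := (hWmem _).1 hu
        rw [map_mul, map_zpow, hNϖ, hNex, ← zpow_natCast, ← zpow_mul] at huk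
        have h3 : ϖ ^ (n * j - k) * ex (.ofAdd (tr x)) = 1 := by
          rw [zpow_sub, ← huk, mul_inv, mul_inv_cancel_left, inv_mul_cancel]
        exact ⟨j, by have := hzero _ _ h3; omega⟩
      · rintro ⟨j, rfl⟩
        refine ⟨ϖ ^ j, (hWmem _).2 ⟨j, 0, by simp⟩, ?_⟩
        rw [map_zpow, hNϖ, zpow_mul, zpow_natCast]
    rw [e2]
    simp
  · rintro _ ⟨u, rfl⟩
    exact mem_ker_autDiv.2 (map_cycNorm s hsn u)
  · refine le_antisymm (fun u hu => mem_range_autDiv_of_cycNorm_eq_one s hsord hn0 u hu) ?_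
    rintro _ ⟨u, rfl⟩
    exact cycNorm_autDiv s hsn u
  · rintro _ ⟨u, hu, rfl⟩
    obtain ⟨k, x, rfl⟩ := (hWmem _).1 hu
    exact (hWmem _).2 ⟨0, d x, by rw [map_mul, map_zpow, hϖs, hfex]; simp⟩
  · rintro _ ⟨u, hu, rfl⟩
    obtain ⟨k, x, rfl⟩ := (hWmem _).1 hu
    exact (hWmem _).2 ⟨n * k, tr x, by rw [map_mul, map_zpow, hNϖ, hNex, zpow_mul, zpow_natCast]⟩
  · rintro u ⟨hu, huW⟩
    obtain ⟨k, x, rfl⟩ := (hWmem _).1 huW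
    have hu' : cycNorm s n (ϖ ^ k * ex (.ofAdd x)) = 1 := hu
    rw [map_mul, map_zpow, hNϖ, hNex, ← zpow_natCast, ← zpow_mul] at hu'
    have hk := hzero _ _ hu'
    have hk0 : k = 0 := by simpa [hn0] using hk
    rw [hk, zpow_zero, one_mul] at hu'
    obtain ⟨y, hy, hyx⟩ := hΛ2 x x.2 (by rw [← htr, hexinj _ hu']; rfl)
    refine ⟨ex (.ofAdd ⟨y, hy⟩), (hWmem _).2 ⟨0, _, by rw [zpow_zero, one_mul]⟩, ?_⟩
    rw [hfex, hk0, zpow_zero, one_mul]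
    congr 2
    exact Subtype.ext hyx

/-- The norm index of a cyclic extension of local fields: if `σ` is an automorphism of order `n`
of a finite extension of `ℚ_[l]`, then the norms have index `n` in the units fixed by `σ`. -/
theorem relIndex_cycNorm [Field L] [Algebra ℚ_[l] L] [FiniteDimensional ℚ_[l] L]
    (σ : L ≃ₐ[ℚ_[l]] L) :
    (cycNorm (σ : L ≃+* L) (orderOf σ)).range.relIndex (autDiv (σ : L ≃+* L)).ker = orderOf σ := by
  let _ := spectralNorm.normedField ℚ_[l] L
  let _ := spectralNorm.normedAlgebra ℚ_[l] L
  have : IsUltrametricDist L :=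
    IsUltrametricDist.isUltrametricDist_of_isNonarchimedean_norm isNonarchimedean_spectralNorm
  exact relIndex_cycNorm_of_normed l σ

end NormIndex

section Kummer

variable {F Ω : Type*} [Field F] [Field Ω] [Algebra F Ω]

theorem isLocallyConstant_galois_apply [Algebra.IsAlgebraic F Ω] (x : Ω) :
    IsLocallyConstant fun g : Ω ≃ₐ[F] Ω => g x := by
  rw [IsLocallyConstant.iff_exists_open]
  intro g
  have : FiniteDimensional F (IntermediateField.adjoin F {x}) :=
    IntermediateField.adjoin.finiteDimensional (Algebra.IsIntegral.isIntegral x)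
  refine ⟨(fun g' => g⁻¹ * g') ⁻¹' ((IntermediateField.adjoin F {x}).fixingSubgroup : Set _),
    (IntermediateField.fixingSubgroup_isOpen _).preimage (continuous_const_mul _), ?_, ?_⟩
  · simp
  · intro g' hg'
    have := (IntermediateField.mem_fixingSubgroup_iff _ _).1 hg' x
      (IntermediateField.mem_adjoin_simple_self F x)
    rw [AlgEquiv.mul_apply] at this
    simpa using congrArg g this

theorem fixingSubgroup_fixedField_of_isOpen [IsGalois F Ω] {N : Subgroup (Ω ≃ₐ[F] Ω)}
    (hN : IsOpen (N : Set (Ω ≃ₐ[F] Ω))) :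
    (IntermediateField.fixedField N).fixingSubgroup = N :=
  InfiniteGalois.fixingSubgroup_fixedField ⟨N, N.isClosed_of_isOpen hN⟩

theorem finiteDimensional_fixedField_of_isOpen [IsGalois F Ω] {N : Subgroup (Ω ≃ₐ[F] Ω)}
    (hN : IsOpen (N : Set (Ω ≃ₐ[F] Ω))) :
    FiniteDimensional F (IntermediateField.fixedField N) := by
  rw [← InfiniteGalois.isOpen_iff_finite, fixingSubgroup_fixedField_of_isOpen hN]
  exact hN

/-- The kernel of an additive function on a subgroup, as a subgroup of the ambient group. -/
def Subgroup.kerOf {G A : Type*} [Group G] [AddGroup A] (H : Subgroup G) (χ : H → A)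
    (hχ : ∀ g h, χ (g * h) = χ g + χ h) : Subgroup G :=
  (MonoidHom.mk' (fun h => Multiplicative.ofAdd (χ h)) fun g h => by
    rw [hχ, ofAdd_add]).ker.map H.subtype

theorem Subgroup.mem_kerOf {G A : Type*} [Group G] [AddGroup A] {H : Subgroup G} {χ : H → A}
    {hχ : ∀ g h, χ (g * h) = χ g + χ h} {g : G} :
    g ∈ H.kerOf χ hχ ↔ ∃ h : g ∈ H, χ ⟨g, h⟩ = 0 := by
  simp only [Subgroup.kerOf, Subgroup.mem_map, MonoidHom.mem_ker]
  constructor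
  · rintro ⟨h, hh, rfl⟩
    exact ⟨h.2, Multiplicative.ofAdd.injective hh⟩
  · rintro ⟨h, hh⟩
    exact ⟨⟨g, h⟩, congrArg Multiplicative.ofAdd hh, rfl⟩

theorem Subgroup.isOpen_kerOf {G A : Type*} [Group G] [TopologicalSpace G] [AddGroup A]
    {H : Subgroup G} (hH : IsOpen (H : Set G)) {χ : H → A}
    (hχ : ∀ g h, χ (g * h) = χ g + χ h) (hc : IsLocallyConstant χ) :
    IsOpen (H.kerOf χ hχ : Set G) := by
  have : (H.kerOf χ hχ : Set G) = Subtype.val '' (χ ⁻¹' {0}) := by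
    ext g
    simp [Subgroup.mem_kerOf]
  rw [this]
  exact hH.isOpenMap_subtype_val _ (hc.isOpen_fiber 0)

theorem AddChar.exists_eq_of_pow_eq_one {n : ℕ} [NeZero n] (ψ : AddChar (ZMod n) F)
    (hψ : Function.Injective ψ) {x : Ω} (hx : x ^ n = 1) : ∃ i, algebraMap F Ω (ψ i) = x := by
  have h1 : IsPrimitiveRoot (ψ 1) n := by
    refine ⟨?_, fun k hk => ?_⟩
    · rw [← ψ.map_nsmul_eq_pow]; simp
    · rw [← ψ.map_nsmul_eq_pow, ← ψ.map_zero_eq_one] at hk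
      simpa [ZMod.natCast_eq_zero_iff] using hψ hk
  obtain ⟨i, -, hi⟩ :=
    (h1.map_of_injective (algebraMap F Ω).injective).eq_pow_of_pow_eq_one hx
  exact ⟨i • 1, by rw [ψ.map_nsmul_eq_pow, map_pow, hi]⟩

theorem AddChar.algebraMap_mul_injective {A : Type*} [AddGroup A] (ψ : AddChar A F)
    (hψ : Function.Injective ψ) {u : Ω} (hu : u ≠ 0) :
    Function.Injective fun i => algebraMap F Ω (ψ i) * u := fun _ _ h =>
  hψ ((algebraMap F Ω).injective (mul_right_cancel₀ hu h))

theorem AddChar.algebraMap_ne_zero {A : Type*} [AddGroup A] (ψ : AddChar A F) (i : A) :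
    algebraMap F Ω (ψ i) ≠ 0 :=
  (map_ne_zero _).2 (ψ.val_isUnit i).ne_zero

variable {p : ℕ} [Fact p.Prime]

/-- A character of an open subgroup of a Galois group with values in `p`-th roots of unity of the
base field occurs on a line spanned by a nonzero element. -/
theorem exists_kummer_generator [IsGalois F Ω] (ψ : AddChar (ZMod p) F)
    {H : Subgroup (Ω ≃ₐ[F] Ω)} (hH : IsOpen (H : Set (Ω ≃ₐ[F] Ω))) {χ : H → ZMod p}
    (hχ : ∀ g h, χ (g * h) = χ g + χ h) (hc : IsLocallyConstant χ) :
    ∃ v : Ω, v ≠ 0 ∧ ∀ h : H, (h : Ω ≃ₐ[F] Ω) v = algebraMap F Ω (ψ (χ h)) * v := by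
  by_cases h0 : ∀ h, χ h = 0
  · exact ⟨1, one_ne_zero, fun h => by simp [h0]⟩
  push Not at h0
  obtain ⟨s, hs⟩ := h0
  have h1 : χ 1 = 0 := by simpa using hχ 1 1
  have hinv : ∀ g, χ g⁻¹ = -χ g := fun g => by
    rw [eq_neg_iff_add_eq_zero, ← hχ, inv_mul_cancel, h1]
  have hpow : ∀ k : ℕ, χ (s ^ k) = k * χ s := by
    intro k
    induction k with
    | zero => simp [h1]
    | succ k ih => rw [pow_succ, hχ, ih]; push_cast; ring
  have hsurj : ∀ i, ∃ h, χ h = i := fun i =>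
    ⟨s ^ (i / χ s).val, by rw [hpow, ZMod.natCast_zmod_val, div_mul_cancel₀ _ hs]⟩
  choose t ht using hsurj
  have hN := Subgroup.isOpen_kerOf hH hχ hc
  set M := IntermediateField.fixedField (H.kerOf χ hχ) with hM
  have hfix := fixingSubgroup_fixedField_of_isOpen hN
  have hMx : ∀ x : M, ∀ g h : H, χ g = χ h → (g : Ω ≃ₐ[F] Ω) x = (h : Ω ≃ₐ[F] Ω) x := by
    intro x g h hgh
    have : (h⁻¹ * g : Ω ≃ₐ[F] Ω) x = x :=
      x.2 ⟨_, Subgroup.mem_kerOf.2 ⟨(h⁻¹ * g).2, by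
        change χ (h⁻¹ * g) = 0
        rw [hχ, hinv, hgh, neg_add_cancel]⟩⟩
    rw [AlgEquiv.mul_apply] at this
    simpa using congrArg (h : Ω ≃ₐ[F] Ω) this
  let e : ZMod p → (M →* Ω) := fun i =>
    ((((t i : Ω ≃ₐ[F] Ω) : Ω →ₐ[F] Ω).comp M.val : M →ₐ[F] Ω) : M →* Ω)
  have he : Function.Injective e := by
    intro i j hij
    have h2 : (t j : Ω ≃ₐ[F] Ω)⁻¹ * t i ∈ M.fixingSubgroup := by
      rw [IntermediateField.mem_fixingSubgroup_iff]
      intro x hx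
      have : (t i : Ω ≃ₐ[F] Ω) x = (t j : Ω ≃ₐ[F] Ω) x := DFunLike.congr_fun hij ⟨x, hx⟩
      rw [AlgEquiv.mul_apply, this]
      simp
    rw [hfix] at h2
    obtain ⟨h3, h4⟩ := Subgroup.mem_kerOf.1 h2
    have h5 : χ ((t j)⁻¹ * t i) = 0 := h4
    rw [hχ, hinv, ht, ht, neg_add_eq_zero] at h5
    exact h5.symm
  have hli := (linearIndependent_monoidHom M Ω).comp e he
  rw [Fintype.linearIndependent_iff] at hli
  have hx : ∃ x : M, ∑ i, algebraMap F Ω (ψ (-i)) * (t i : Ω ≃ₐ[F] Ω) x ≠ 0 := by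
    by_contra! hcon
    refine (ψ.algebraMap_ne_zero (Ω := Ω) (-0)) (hli (fun i => algebraMap F Ω (ψ (-i))) ?_ 0)
    ext x
    simpa [e, Algebra.smul_def] using hcon x
  obtain ⟨x, hx⟩ := hx
  refine ⟨_, hx, fun h => ?_⟩
  rw [map_sum, Finset.mul_sum]
  refine Fintype.sum_equiv (Equiv.addLeft (χ h)) _ _ fun i => ?_
  rw [map_mul, AlgEquiv.commutes, Equiv.coe_addLeft, ← mul_assoc, ← map_mul, ← ψ.map_add_eq_mul]
  congr 1
  · congr 2; ring
  · exact hMx x (h * t i) (t (χ h + i)) (by rw [hχ, ht, ht])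

/-- If the base field contains a primitive `p²`-th root of unity, then characters of open subgroups
of its absolute Galois group with values in `ZMod p` lift to characters with values in
`ZMod (p ^ 2)`. -/
theorem exists_character_lift [IsGalois F Ω] [IsSepClosed Ω] [CharZero Ω]
    (Ψ : AddChar (ZMod (p ^ 2)) F) (hΨ : Function.Injective Ψ)
    (ψ : AddChar (ZMod p) F) (hψ : Function.Injective ψ)
    (hΨψ : ∀ X, Ψ X ^ p = ψ (ZMod.castHom (dvd_pow_self p two_ne_zero) (ZMod p) X))
    {H : Subgroup (Ω ≃ₐ[F] Ω)} (hH : IsOpen (H : Set (Ω ≃ₐ[F] Ω))) {χ : H → ZMod p}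
    (hχ : ∀ g h, χ (g * h) = χ g + χ h) (hc : IsLocallyConstant χ) :
    ∃ X : H → ZMod (p ^ 2), (∀ g h, X (g * h) = X g + X h) ∧ IsLocallyConstant X ∧
      ∀ h, ZMod.castHom (dvd_pow_self p two_ne_zero) (ZMod p) (X h) = χ h := by
  obtain ⟨u, hu, huχ⟩ := exists_kummer_generator ψ hH hχ hc
  have hp0 : p ≠ 0 := (Fact.out : p.Prime).ne_zero
  have : NeZero ((p : ℕ) : Ω) := ⟨by exact_mod_cast hp0⟩
  obtain ⟨w, rfl⟩ := IsSepClosed.exists_pow_nat_eq u p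
  have hw : w ≠ 0 := fun h => hu (by rw [h, zero_pow hp0])
  have hX : ∀ h : H, ∃ i, algebraMap F Ω (Ψ i) * w = (h : Ω ≃ₐ[F] Ω) w := by
    intro h
    obtain ⟨i, hi⟩ := Ψ.exists_eq_of_pow_eq_one hΨ (x := (h : Ω ≃ₐ[F] Ω) w / w) (by
      rw [pow_two, pow_mul, div_pow, ← map_pow, huχ, mul_div_cancel_right₀ _ hu, ← map_pow,
        ← ψ.map_nsmul_eq_pow, nsmul_eq_mul, CharP.cast_eq_zero, zero_mul, ψ.map_zero_eq_one,
        map_one])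
    exact ⟨i, by rw [hi, div_mul_cancel₀ _ hw]⟩
  choose X hX using hX
  refine ⟨X, fun g h => ?_, ?_, fun h => ?_⟩
  · apply Ψ.algebraMap_mul_injective hΨ hw
    dsimp only
    rw [hX, Subgroup.coe_mul, AlgEquiv.mul_apply, ← hX h, map_mul, AlgEquiv.commutes, ← hX g,
      Ψ.map_add_eq_mul, map_mul]
    ring
  · refine IsLocallyConstant.desc X (fun i => algebraMap F Ω (Ψ i) * w) ?_
      (Ψ.algebraMap_mul_injective hΨ hw)
    have := (isLocallyConstant_galois_apply (F := F) w).comp_continuous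
      (continuous_subtype_val (p := (· ∈ H)))
    convert this using 1
    exact funext hX
  · apply ψ.algebraMap_mul_injective hψ hu
    dsimp only
    rw [← huχ, map_pow, ← hX, mul_pow, ← map_pow, hΨψ]

end Kummer

section CyclicExtension

variable {F Ω : Type*} [Field F] [Field Ω] [Algebra F Ω]

/-- An automorphism normalizing a subgroup `N` restricts to the fixed field of `N`. -/
theorem exists_restrict_fixedField {N : Subgroup (Ω ≃ₐ[F] Ω)} {s : Ω ≃ₐ[F] Ω}
    (hs : ∀ g ∈ N, s⁻¹ * g * s ∈ N) (hs' : ∀ g ∈ N, s * g * s⁻¹ ∈ N) :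
    ∃ σ : IntermediateField.fixedField N ≃ₐ[F] IntermediateField.fixedField N,
      ∀ x, (σ x : Ω) = s x := by
  have h1 : ∀ x : IntermediateField.fixedField N, s x ∈ IntermediateField.fixedField N := by
    rintro x ⟨g, hg⟩
    have := x.2 ⟨_, hs g hg⟩
    change (s⁻¹ * g * s) (x : Ω) = x at this
    rw [AlgEquiv.mul_apply, AlgEquiv.mul_apply] at this
    change g (s x) = s x
    simpa using congrArg s this
  have h2 : ∀ x : IntermediateField.fixedField N, s⁻¹ x ∈ IntermediateField.fixedField N := by
    rintro x ⟨g, hg⟩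
    have := x.2 ⟨_, hs' g hg⟩
    change (s * g * s⁻¹) (x : Ω) = x at this
    rw [AlgEquiv.mul_apply, AlgEquiv.mul_apply] at this
    change g (s⁻¹ x) = s⁻¹ x
    simpa using congrArg (s⁻¹ : Ω ≃ₐ[F] Ω) this
  refine ⟨AlgEquiv.ofAlgHom
    (((s : Ω →ₐ[F] Ω).comp (IntermediateField.val _)).codRestrict
      (IntermediateField.fixedField N).toSubalgebra h1)
    ((((s⁻¹ : Ω ≃ₐ[F] Ω) : Ω →ₐ[F] Ω).comp (IntermediateField.val _)).codRestrict
      (IntermediateField.fixedField N).toSubalgebra h2) ?_ ?_, fun x => rfl⟩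
  · ext x
    exact s.apply_symm_apply x
  · ext x
    exact s.symm_apply_apply x

/-- The units of a field fixed by a group of automorphisms. -/
def fixedUnits (H : Subgroup (Ω ≃ₐ[F] Ω)) : Subgroup Ωˣ where
  carrier := {x | ∀ h ∈ H, h (x : Ω) = x}
  mul_mem' hx hy h hh := by rw [Units.val_mul, map_mul, hx h hh, hy h hh]
  one_mem' h _ := by rw [Units.val_one, map_one]
  inv_mem' {x} hx h hh := by rw [Units.val_inv_eq_inv_val, map_inv₀, hx h hh]

variable {n : ℕ} {H : Subgroup (Ω ≃ₐ[F] Ω)} {X : H → ZMod n}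

theorem map_inv_of_additive {G A : Type*} [Group G] [AddGroup A] {f : G → A}
    (hf : ∀ g h, f (g * h) = f g + f h) (g : G) : f g⁻¹ = -f g := by
  have h1 : f 1 = 0 := by simpa using hf 1 1
  rw [eq_neg_iff_add_eq_zero, ← hf, inv_mul_cancel, h1]

theorem map_pow_of_additive {G : Type*} [Group G] {f : G → ZMod n}
    (hf : ∀ g h, f (g * h) = f g + f h) (g : G) (k : ℕ) : f (g ^ k) = k * f g := by
  have h1 : f 1 = 0 := by simpa using hf 1 1
  induction k with
  | zero => simp [h1]
  | succ k ih => rw [pow_succ, hf, ih]; push_cast; ring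

theorem Subgroup.conj_mem_kerOf {G A : Type*} [Group G] [AddCommGroup A] {H : Subgroup G}
    {χ : H → A} {hχ : ∀ g h, χ (g * h) = χ g + χ h} (s : H)
    {g : G} (hg : g ∈ H.kerOf χ hχ) : (s : G)⁻¹ * g * s ∈ H.kerOf χ hχ := by
  obtain ⟨h1, h2⟩ := Subgroup.mem_kerOf.1 hg
  have h3 : χ (s⁻¹ * ⟨g, h1⟩ * s) = 0 := by
    rw [hχ, hχ, h2, map_inv_of_additive hχ, add_zero, neg_add_cancel]
  exact Subgroup.mem_kerOf.2 ⟨(s⁻¹ * ⟨g, h1⟩ * s).2, h3⟩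

theorem mem_fixedField_kerOf (hX : ∀ g h, X (g * h) = X g + X h) {x : Ω} :
    x ∈ IntermediateField.fixedField (H.kerOf X hX) ↔ ∀ h : H, X h = 0 → h.1 x = x := by
  constructor
  · intro hx h hh
    exact hx ⟨h, Subgroup.mem_kerOf.2 ⟨h.2, hh⟩⟩
  · rintro hx ⟨g, hg⟩
    obtain ⟨h1, h2⟩ := Subgroup.mem_kerOf.1 hg
    exact hx ⟨g, h1⟩ h2

theorem apply_eq_pow_apply [NeZero n] (hX : ∀ g h, X (g * h) = X g + X h) {s : H} (hs : X s = 1)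
    {y : Ω} (hy : ∀ h : H, X h = 0 → h.1 y = y) (h : H) :
    h.1 y = (s.1 ^ (X h).val) y := by
  have := hy ((s ^ (X h).val)⁻¹ * h) (by
    rw [hX, map_inv_of_additive hX, map_pow_of_additive hX, hs, mul_one, ZMod.natCast_zmod_val,
      neg_add_cancel])
  rw [Subgroup.coe_mul, AlgEquiv.mul_apply] at this
  simpa using congrArg (s ^ (X h).val).1 this

theorem forall_apply_eq_of_apply_eq [NeZero n] (hX : ∀ g h, X (g * h) = X g + X h) {s : H}
    (hs : X s = 1) {y : Ω} (hy : ∀ h : H, X h = 0 → h.1 y = y) (hsy : s.1 y = y) (h : H) :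
    h.1 y = y := by
  rw [apply_eq_pow_apply hX hs hy]
  generalize (X h).val = k
  induction k with
  | zero => rfl
  | succ k ih => rw [pow_succ, AlgEquiv.mul_apply, hsy, ih]

theorem apply_fixed_of_fixed (hX : ∀ g h, X (g * h) = X g + X h)
    {y : Ω} (hy : ∀ h : H, X h = 0 → h.1 y = y) (g : H) (h : H) (hh : X h = 0) :
    h.1 (g.1 y) = g.1 y := by
  have := hy (g⁻¹ * h * g) (by rw [hX, hX, hh, map_inv_of_additive hX]; abel)
  simp only [Subgroup.coe_mul, AlgEquiv.mul_apply] at this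
  simpa using congrArg g.1 this

theorem coe_pow_of_forall_coe {M : IntermediateField F Ω} {σ : M ≃ₐ[F] M} {s : Ω ≃ₐ[F] Ω}
    (h : ∀ x, (σ x : Ω) = s x) (i : ℕ) (x : M) : ((σ ^ i) x : Ω) = (s ^ i) x := by
  induction i generalizing x with
  | zero => rfl
  | succ i ih => rw [pow_succ, AlgEquiv.mul_apply, ih, h, pow_succ, AlgEquiv.mul_apply]

theorem exists_cyclic_restrict [IsGalois F Ω] (hH : IsOpen (H : Set (Ω ≃ₐ[F] Ω)))
    (hX : ∀ g h, X (g * h) = X g + X h) (hc : IsLocallyConstant X) {s : H} (hs : X s = 1) :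
    ∃ (L : IntermediateField F Ω) (σ : L ≃ₐ[F] L),
      (∀ x, x ∈ L ↔ ∀ h : H, X h = 0 → h.1 x = x) ∧ FiniteDimensional F L ∧
      (∀ x, (σ x : Ω) = s.1 x) ∧ orderOf σ = n := by
  obtain ⟨σ, hσ⟩ := exists_restrict_fixedField (N := H.kerOf X hX)
    (fun g hg => Subgroup.conj_mem_kerOf s hg)
    (fun g hg => by simpa using Subgroup.conj_mem_kerOf s⁻¹ hg)
  have hN := Subgroup.isOpen_kerOf hH hX hc
  refine ⟨_, σ, fun x => mem_fixedField_kerOf hX, finiteDimensional_fixedField_of_isOpen hN, hσ, ?_⟩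
  have hfix := fixingSubgroup_fixedField_of_isOpen hN
  have hmem : ∀ g, g ∈ H.kerOf X hX ↔ ∃ h : g ∈ H, X ⟨g, h⟩ = 0 :=
    fun g => Subgroup.mem_kerOf
  generalize H.kerOf X hX = N at σ hσ hfix hmem
  have key : ∀ k : ℕ, σ ^ k = 1 ↔ n ∣ k := by
    intro k
    have h1 : σ ^ k = 1 ↔ (s ^ k).1 ∈ N := by
      rw [← SetLike.ext_iff.1 hfix, IntermediateField.mem_fixingSubgroup_iff]
      constructor
      · intro h x hx
        have := coe_pow_of_forall_coe hσ k ⟨x, hx⟩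
        rw [h] at this
        exact this.symm
      · intro h
        ext x
        rw [coe_pow_of_forall_coe hσ]
        exact h x x.2
    rw [h1, hmem, ← ZMod.natCast_eq_zero_iff]
    have h2 : X (s ^ k) = k := by rw [map_pow_of_additive hX, hs, mul_one]
    exact ⟨fun ⟨_, h⟩ => h2.symm.trans h, fun h => ⟨(s ^ k).2, h2.trans h⟩⟩
  exact Nat.dvd_antisymm (orderOf_dvd_of_pow_eq_one ((key n).2 dvd_rfl))
    ((key _).1 (pow_orderOf_eq_one σ))

theorem coe_ringEquiv_pow {M : Type*} [Field M] [Algebra F M] (σ : M ≃ₐ[F] M) (i : ℕ) (x : M) :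
    ((σ : M ≃+* M) ^ i) x = (σ ^ i) x := by
  induction i generalizing x with
  | zero => rfl
  | succ i ih => rw [pow_succ, RingAut.mul_apply, ih, pow_succ, AlgEquiv.mul_apply]; rfl

theorem orderOf_coe_ringEquiv {M : Type*} [Field M] [Algebra F M] (σ : M ≃ₐ[F] M) :
    orderOf (σ : M ≃+* M) = orderOf σ := by
  refine orderOf_eq_orderOf_iff.2 fun i => ?_
  constructor
  · intro h; ext x; rw [← coe_ringEquiv_pow, h]; rfl
  · intro h; ext x; rw [coe_ringEquiv_pow, h]; rfl

/-- The norm index of a cyclic extension of local fields, for the extension cut out by a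
`ZMod n`-valued character of an open subgroup of a Galois group. -/
theorem exists_norm_subgroup (l : ℕ) [Fact l.Prime] [Algebra ℚ_[l] F] [FiniteDimensional ℚ_[l] F]
    [IsGalois F Ω] [NeZero n] (hH : IsOpen (H : Set (Ω ≃ₐ[F] Ω)))
    (hX : ∀ g h, X (g * h) = X g + X h) (hc : IsLocallyConstant X) {s : H} (hs : X s = 1) :
    ∃ N : Subgroup Ωˣ,
      (∀ x, x ∈ N ↔ ∃ y : Ωˣ, (∀ h : H, X h = 0 → h.1 (y : Ω) = y) ∧
        ∏ i ∈ Finset.range n, (s.1 ^ i) (y : Ω) = x) ∧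
      N.relIndex (fixedUnits H) = n := by
  obtain ⟨L, σ, hL, hfd, hσ, hord⟩ := exists_cyclic_restrict hH hX hc hs
  let _ : Algebra ℚ_[l] L := ((algebraMap F L).comp (algebraMap ℚ_[l] F)).toAlgebra
  have : IsScalarTower ℚ_[l] F L := IsScalarTower.of_algebraMap_eq fun _ => rfl
  have : FiniteDimensional ℚ_[l] L := FiniteDimensional.trans ℚ_[l] F L
  have hrel := relIndex_cycNorm l (σ.restrictScalars ℚ_[l])
  have e1 : ((σ.restrictScalars ℚ_[l] : L ≃ₐ[ℚ_[l]] L) : L ≃+* L) = (σ : L ≃+* L) := rfl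
  have e2 : orderOf (σ.restrictScalars ℚ_[l]) = n := by
    rw [← orderOf_coe_ringEquiv, e1, orderOf_coe_ringEquiv, hord]
  rw [e1, e2] at hrel
  let ι : Lˣ →* Ωˣ := Units.map (L.val : L →* Ω)
  have hι : Function.Injective ι := Units.map_injective L.val.injective
  have hιc : ∀ y, (ι y : Ω) = (y : L) := fun _ => rfl
  have hnorm : ∀ y : Lˣ, ((cycNorm (σ : L ≃+* L) n y : L) : Ω)
      = ∏ i ∈ Finset.range n, (s.1 ^ i) ((y : L) : Ω) := by
    intro y
    rw [coe_cycNorm, ← IntermediateField.coe_val, map_prod]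
    refine Finset.prod_congr rfl fun i _ => ?_
    rw [coe_ringEquiv_pow, IntermediateField.coe_val, coe_pow_of_forall_coe hσ]
  have hlift : ∀ y : Ωˣ, (∀ h : H, X h = 0 → h.1 (y : Ω) = y) → ∃ z, ι z = y := by
    intro y hy
    exact ⟨Units.mk0 ⟨y, (hL _).2 hy⟩
      (fun h => y.ne_zero (congrArg Subtype.val h)), Units.ext rfl⟩
  refine ⟨(cycNorm (σ : L ≃+* L) n).range.map ι, fun x => ?_, ?_⟩
  · constructor
    · rintro ⟨_, ⟨y, rfl⟩, rfl⟩
      exact ⟨ι y, (hL _).1 (y : L).2, (hnorm y).symm⟩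
    · rintro ⟨y, hy, hyx⟩
      obtain ⟨z, rfl⟩ := hlift y hy
      exact ⟨_, ⟨z, rfl⟩, Units.ext ((hnorm z).trans hyx)⟩
  · have e3 : fixedUnits H = (autDiv (σ : L ≃+* L)).ker.map ι := by
      ext x
      constructor
      · intro hx
        obtain ⟨z, rfl⟩ := hlift x fun h _ => hx h h.2
        refine ⟨z, mem_ker_autDiv.2 ?_, rfl⟩
        exact Subtype.ext ((hσ _).trans (hx s.1 s.2))
      · rintro ⟨z, hz, rfl⟩ h hh
        refine forall_apply_eq_of_apply_eq hX hs ((hL _).1 (z : L).2) ?_ ⟨h, hh⟩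
        exact (hσ _).symm.trans (congrArg Subtype.val (mem_ker_autDiv.1 hz))
    rw [e3, Subgroup.relIndex_map_map_of_injective _ _ hι, hrel]

/-- Hilbert's Theorem 90 for an intermediate step of the cyclic extension cut out by a
`ZMod n`-valued character of an open subgroup of a Galois group. -/
theorem exists_apply_eq_mul_of_prod_eq_one [IsGalois F Ω] [NeZero n]
    (hH : IsOpen (H : Set (Ω ≃ₐ[F] Ω)))
    (hX : ∀ g h, X (g * h) = X g + X h) (hc : IsLocallyConstant X) {s : H} (hs : X s = 1)
    {m d : ℕ} (hmd : n = m * d) {z : Ω} (hz : ∀ h : H, X h = 0 → h.1 z = z)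
    (hz1 : ∏ i ∈ Finset.range d, (s.1 ^ (m * i)) z = 1) :
    ∃ v : Ω, v ≠ 0 ∧ (∀ h : H, X h = 0 → h.1 v = v) ∧ (s.1 ^ m) v = z * v := by
  obtain ⟨L, σ, hL, -, hσ, hord⟩ := exists_cyclic_restrict hH hX hc hs
  have hn0 : n ≠ 0 := NeZero.ne n
  have hm0 : m ≠ 0 := by rintro rfl; simp [hn0] at hmd
  have hd0 : d ≠ 0 := by rintro rfl; simp [hn0] at hmd
  have hz0 : z ≠ 0 := by
    rintro rfl
    simp only [map_zero] at hz1
    rw [Finset.prod_const, Finset.card_range, zero_pow hd0] at hz1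
    exact zero_ne_one hz1
  have hord' : orderOf ((σ ^ m : L ≃ₐ[F] L) : L ≃+* L) = d := by
    rw [orderOf_coe_ringEquiv, orderOf_pow_of_dvd hm0 (by rw [hord, hmd]; exact dvd_mul_right _ _),
      hord, hmd, Nat.mul_div_cancel_left _ (Nat.pos_of_ne_zero hm0)]
  let z' : Lˣ := Units.mk0 ⟨z, (hL _).2 hz⟩
      (fun h => hz0 (congrArg Subtype.val h))
  obtain ⟨v, hv⟩ := mem_range_autDiv_of_cycNorm_eq_one _ hord' hd0 z' (by
    ext
    rw [coe_cycNorm, ← IntermediateField.coe_val, map_prod, Units.val_one,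
      IntermediateField.coe_val, OneMemClass.coe_one, ← hz1]
    refine Finset.prod_congr rfl fun i _ => ?_
    rw [coe_ringEquiv_pow, ← pow_mul]
    exact coe_pow_of_forall_coe hσ _ _)
  refine ⟨(v : L), fun h => v.ne_zero (Subtype.ext h), (hL _).1 (v : L).2, ?_⟩
  have h1 := congrArg (Units.val) hv
  rw [coe_autDiv, div_eq_iff v.ne_zero] at h1
  rw [← coe_pow_of_forall_coe hσ]
  exact congrArg Subtype.val h1

end CyclicExtension

section NormCriterion

theorem Subgroup.exists_mul_pow_mem_of_index {A : Type*} [CommGroup A] {p : ℕ} (hp : p.Prime)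
    {N M : Subgroup A} (hN : N.index = p ^ 2) (hM : M.index = p) (hNM : N ≤ M)
    (hpow : ∀ x, x ^ p ∈ N → x ∈ M) {a : A} (ha : a ∈ M) : ∃ x, a * x ^ p ∈ N := by
  have hMtop : M ≠ ⊤ := by
    rintro rfl
    rw [Subgroup.index_top] at hM
    exact hp.one_lt.ne hM
  obtain ⟨x, hx⟩ : ∃ x, x ∉ M := by
    by_contra! h
    exact hMtop (eq_top_iff.2 fun x _ => h x)
  have hcard : Nat.card (A ⧸ N) = p ^ 2 := hN
  have : Finite (A ⧸ N) := Nat.finite_of_card_ne_zero (by rw [hcard]; exact pow_ne_zero _ hp.ne_zero)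
  have hord : orderOf (x : A ⧸ N) = p ^ 2 := by
    obtain ⟨k, hk, hk'⟩ := (Nat.dvd_prime_pow hp).1 (hcard ▸ _root_.orderOf_dvd_natCard (x : A ⧸ N))
    have h1 : ¬ orderOf (x : A ⧸ N) ∣ p := by
      rw [orderOf_dvd_iff_pow_eq_one, ← QuotientGroup.mk_pow, QuotientGroup.eq_one_iff]
      exact fun h => hx (hpow x h)
    interval_cases k
    · exact absurd (by rw [hk', pow_zero]; exact one_dvd p) h1
    · exact absurd (by rw [hk', pow_one]) h1
    · exact hk'
  have hgen : (a : A ⧸ N) ∈ Subgroup.zpowers (x : A ⧸ N) := by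
    have : Subgroup.zpowers (x : A ⧸ N) = ⊤ := by
      apply Subgroup.eq_top_of_card_eq
      rw [Nat.card_zpowers, hord, hcard]
    rw [this]; trivial
  obtain ⟨k, hk⟩ := hgen
  have hk' : (x ^ k)⁻¹ * a ∈ N := by
    rw [← QuotientGroup.eq, QuotientGroup.mk_zpow]
    exact hk
  have hxk : x ^ k ∈ M := by
    have := M.mul_mem ha (M.inv_mem (hNM hk'))
    simpa using this
  have hordM : orderOf (x : A ⧸ M) = p := by
    have hc : Nat.card (A ⧸ M) = p := hM
    refine (hp.eq_one_or_self_of_dvd _ (hc ▸ _root_.orderOf_dvd_natCard (x : A ⧸ M))).resolve_left ?_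
    rw [orderOf_eq_one_iff, QuotientGroup.eq_one_iff]
    exact hx
  have hdvd : (p : ℤ) ∣ k := by
    rw [← hordM, orderOf_dvd_iff_zpow_eq_one, ← QuotientGroup.mk_zpow, QuotientGroup.eq_one_iff]
    exact hxk
  obtain ⟨m, rfl⟩ := hdvd
  refine ⟨x ^ (-m), ?_⟩
  rwa [mul_comm, ← zpow_natCast, ← zpow_mul, neg_mul, zpow_neg, mul_comm m]

theorem Subgroup.exists_mul_pow_mem_of_relIndex {A : Type*} [CommGroup A] {p : ℕ} (hp : p.Prime)
    {N M E : Subgroup A} (hN : N.relIndex E = p ^ 2) (hM : M.relIndex E = p) (hNM : N ≤ M)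
    (hpow : ∀ x ∈ E, x ^ p ∈ N → x ∈ M) {a : A} (haE : a ∈ E) (ha : a ∈ M) :
    ∃ x ∈ E, a * x ^ p ∈ N := by
  obtain ⟨x, hx⟩ := Subgroup.exists_mul_pow_mem_of_index hp (N := N.subgroupOf E)
    (M := M.subgroupOf E) hN hM (fun x hx => hNM hx) (fun x hx => hpow x x.2 hx)
    (a := ⟨a, haE⟩) ha
  exact ⟨x, x.2, hx⟩

theorem Finset.prod_range_mul_eq {M : Type*} [CommMonoid M] (f : ℕ → M) (m d : ℕ) :
    ∏ i ∈ Finset.range (m * d), f i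
      = ∏ k ∈ Finset.range d, ∏ j ∈ Finset.range m, f (m * k + j) := by
  induction d with
  | zero => simp
  | succ d ih => rw [Nat.mul_succ, Finset.prod_range_add, ih, Finset.prod_range_succ]

variable {F Ω : Type*} [Field F] [Field Ω] [Algebra F Ω]

theorem map_prod_pow_mul_self (t : Ω ≃ₐ[F] Ω) (n : ℕ) (y : Ω) :
    t (∏ i ∈ Finset.range n, (t ^ i) y) * y = (∏ i ∈ Finset.range n, (t ^ i) y) * (t ^ n) y := by
  rw [← Finset.prod_range_succ, Finset.prod_range_succ', map_prod]
  simp only [pow_succ', AlgEquiv.mul_apply, pow_zero, AlgEquiv.one_apply]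

theorem prod_pow_mul_map (t : Ω ≃ₐ[F] Ω) (n : ℕ) {v : Ω} (hv : v ≠ 0) :
    (∏ i ∈ Finset.range n, (t ^ i) (v / t v)) * (t ^ n) v = v := by
  induction n with
  | zero => simp
  | succ n ih =>
    rw [Finset.prod_range_succ, map_div₀, ← AlgEquiv.mul_apply, ← pow_succ, mul_assoc,
      div_mul_cancel₀ _ ((map_ne_zero _).2 hv), ih]

variable {p : ℕ} [Fact p.Prime] {H : Subgroup (Ω ≃ₐ[F] Ω)} {B : H → ZMod (p ^ 2)}

local notation "π" => ZMod.castHom (dvd_pow_self p two_ne_zero) (ZMod p)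

theorem castHom_eq_zero_iff (X : ZMod (p ^ 2)) : π X = 0 ↔ p ∣ X.val := by
  rw [← ZMod.natCast_eq_zero_iff, ZMod.castHom_apply, ZMod.natCast_val]

theorem apply_eq_of_castHom_eq_zero (hB : ∀ g h, B (g * h) = B g + B h) {s : H} (hs : B s = 1)
    {y : Ω} (hy : ∀ h : H, B h = 0 → h.1 y = y) (hsy : (s.1 ^ p) y = y) (h : H)
    (hh : π (B h) = 0) : h.1 y = y := by
  rw [apply_eq_pow_apply hB hs hy]
  obtain ⟨m, hm⟩ := (castHom_eq_zero_iff _).1 hh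
  rw [hm]
  clear hm
  induction m with
  | zero => rfl
  | succ m ih => rw [Nat.mul_succ, pow_add, AlgEquiv.mul_apply, hsy, ih]

omit [Fact p.Prime] in
theorem pow_apply_of_fixed (hB : ∀ g h, B (g * h) = B g + B h) {s : H}
    {y : Ω} (hy : ∀ h : H, B h = 0 → h.1 y = y) (k : ℕ) :
    ∀ h : H, B h = 0 → h.1 ((s.1 ^ k) y) = (s.1 ^ k) y :=
  fun h hh => apply_fixed_of_fixed hB hy (s ^ k) h hh

omit [Fact p.Prime] in
theorem prod_pow_apply_of_fixed (hB : ∀ g h, B (g * h) = B g + B h) {s : H}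
    {y : Ω} (hy : ∀ h : H, B h = 0 → h.1 y = y) (f : ℕ → ℕ) (t : Finset ℕ) :
    ∀ h : H, B h = 0 → h.1 (∏ k ∈ t, (s.1 ^ f k) y) = ∏ k ∈ t, (s.1 ^ f k) y := fun h hh => by
  rw [map_prod]
  exact Finset.prod_congr rfl fun k _ => pow_apply_of_fixed hB hy _ h hh

/-- Let `L/K/E` be the tower cut out by a `ZMod (p ^ 2)`-valued character. If the `p`-th power of
an element of the base `E` is a norm from `L`, then the element is a norm from `K`. -/
theorem exists_norm_of_pow_eq_norm [IsGalois F Ω] (hH : IsOpen (H : Set (Ω ≃ₐ[F] Ω)))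
    (hB : ∀ g h, B (g * h) = B g + B h) (hc : IsLocallyConstant B) {s : H} (hs : B s = 1)
    {x y : Ω} (hx0 : x ≠ 0) (hy0 : y ≠ 0) (hx : ∀ h : H, h.1 x = x)
    (hy : ∀ h : H, B h = 0 → h.1 y = y)
    (hxy : ∏ i ∈ Finset.range (p ^ 2), (s.1 ^ i) y = x ^ p) :
    ∃ e : Ω, e ≠ 0 ∧ (∀ h : H, π (B h) = 0 → h.1 e = e) ∧
      ∏ i ∈ Finset.range p, (s.1 ^ i) e = x := by
  have hn : NeZero (p ^ 2) := ⟨pow_ne_zero _ (Fact.out : p.Prime).ne_zero⟩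
  set N := ∏ i ∈ Finset.range p, (s.1 ^ i) y with hN
  have hN0 : N ≠ 0 := Finset.prod_ne_zero_iff.2 fun i _ => (map_ne_zero _).2 hy0
  have hNfix : ∀ h : H, B h = 0 → h.1 N = N := prod_pow_apply_of_fixed hB hy id _
  have hxs : ∀ k, (s.1 ^ k) x = x := fun k => hx (s ^ k)
  obtain ⟨v, hv0, hv, hsv⟩ := exists_apply_eq_mul_of_prod_eq_one hH hB hc hs (pow_two p)
    (z := N / x) (fun h hh => by rw [map_div₀, hNfix h hh, hx]) (by
      simp only [map_div₀, hxs]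
      rw [Finset.prod_div_distrib, Finset.prod_const, Finset.card_range, ← hxy, pow_two,
        Finset.prod_range_mul_eq, div_eq_one_iff_eq]
      · refine Finset.prod_congr rfl fun k _ => ?_
        rw [hN, map_prod]
        refine Finset.prod_congr rfl fun j _ => ?_
        rw [← AlgEquiv.mul_apply, ← pow_add]
      · exact Finset.prod_ne_zero_iff.2 fun k _ => Finset.prod_ne_zero_iff.2 fun j _ =>
          (map_ne_zero _).2 hy0)
  have hsv0 : s.1 v ≠ 0 := (map_ne_zero _).2 hv0
  have hsy : s.1 N * y = N * (s.1 ^ p) y := map_prod_pow_mul_self s.1 p y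
  refine ⟨y * (v / s.1 v), mul_ne_zero hy0 (div_ne_zero hv0 hsv0), ?_, ?_⟩
  · refine apply_eq_of_castHom_eq_zero hB hs (fun h hh => ?_) ?_
    · rw [map_mul, map_div₀, hy h hh, hv h hh, apply_fixed_of_fixed hB hv s h hh]
    · have h1 : (s.1 ^ p) (s.1 v) = s.1 N / x * s.1 v := by
        rw [← AlgEquiv.mul_apply, ← pow_succ, pow_succ', AlgEquiv.mul_apply, hsv, map_mul,
          map_div₀, hx]
      have hsN0 : s.1 N ≠ 0 := (map_ne_zero _).2 hN0
      rw [map_mul, map_div₀, hsv, h1]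
      field_simp
      linear_combination -hsy
  · have h1 := prod_pow_mul_map s.1 p hv0
    simp only [map_mul]
    rw [Finset.prod_mul_distrib, ← hN]
    rw [hsv] at h1
    field_simp at h1
    linear_combination h1

/-- In the tower of local fields `L/K/E` cut out by a `ZMod (p ^ 2)`-valued character, every norm
from `K` is a `p`-th power times a norm from `L`. -/
theorem exists_norm_eq_mul_pow (l : ℕ) [Fact l.Prime] [Algebra ℚ_[l] F]
    [FiniteDimensional ℚ_[l] F] [IsGalois F Ω] (hH : IsOpen (H : Set (Ω ≃ₐ[F] Ω)))
    (hB : ∀ g h, B (g * h) = B g + B h) (hc : IsLocallyConstant B) {s : H} (hs : B s = 1)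
    {α w : Ω} (hw0 : w ≠ 0) (hα : ∀ h : H, h.1 α = α)
    (hw : ∀ h : H, π (B h) = 0 → h.1 w = w)
    (hwα : ∏ i ∈ Finset.range p, (s.1 ^ i) w = α) :
    ∃ x y : Ω, x ≠ 0 ∧ y ≠ 0 ∧ (∀ h : H, h.1 x = x) ∧ (∀ h : H, B h = 0 → h.1 y = y) ∧
      ∏ i ∈ Finset.range (p ^ 2), (s.1 ^ i) y = α * x ^ p := by
  have hn : NeZero (p ^ 2) := ⟨pow_ne_zero _ (Fact.out : p.Prime).ne_zero⟩
  obtain ⟨N, hN, hNrel⟩ := exists_norm_subgroup l hH hB hc hs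
  obtain ⟨M, hM, hMrel⟩ := exists_norm_subgroup l hH (X := fun h => π (B h))
    (fun g h => by rw [hB, map_add]) (hc.comp _) (s := s) (by rw [hs, map_one])
  have hα0 : α ≠ 0 := by
    rw [← hwα]
    exact Finset.prod_ne_zero_iff.2 fun i _ => (map_ne_zero _).2 hw0
  have hNM : N ≤ M := by
    intro x hx
    obtain ⟨y, hy, hyx⟩ := (hN _).1 hx
    set y' := ∏ k ∈ Finset.range p, (s.1 ^ (p * k)) (y : Ω) with hy'
    have hy'0 : y' ≠ 0 := Finset.prod_ne_zero_iff.2 fun i _ => (map_ne_zero _).2 y.ne_zero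
    refine (hM _).2 ⟨Units.mk0 y' hy'0, ?_, ?_⟩
    · refine apply_eq_of_castHom_eq_zero hB hs (y := y')
        (prod_pow_apply_of_fixed hB hy (fun k => p * k) _) ?_
      have h1 := map_prod_pow_mul_self (s.1 ^ p) p (y : Ω)
      simp only [← pow_mul] at h1
      have h2 : (s.1 ^ (p * p)) (y : Ω) = y := hy (s ^ (p * p)) (by
        rw [map_pow_of_additive hB, hs, mul_one, ZMod.natCast_eq_zero_iff, pow_two])
      rw [h2] at h1
      exact mul_right_cancel₀ y.ne_zero h1
    · rw [← hyx, pow_two, Finset.prod_range_mul_eq, Finset.prod_comm]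
      refine Finset.prod_congr rfl fun j _ => ?_
      rw [Units.val_mk0, hy', map_prod]
      refine Finset.prod_congr rfl fun k _ => ?_
      rw [← AlgEquiv.mul_apply, ← pow_add, add_comm]
  have hpow : ∀ x ∈ fixedUnits H, x ^ p ∈ N → x ∈ M := by
    intro x hx hxp
    obtain ⟨y, hy, hyx⟩ := (hN _).1 hxp
    obtain ⟨e, he0, he, hex⟩ := exists_norm_of_pow_eq_norm hH hB hc hs x.ne_zero y.ne_zero
      (fun h => hx h h.2) hy (by rw [hyx, Units.val_pow_eq_pow_val])
    exact (hM _).2 ⟨Units.mk0 e he0, he, hex⟩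
  obtain ⟨x, hx, hxN⟩ := Subgroup.exists_mul_pow_mem_of_relIndex (Fact.out : p.Prime) hNrel hMrel
    hNM hpow (a := Units.mk0 α hα0) (fun h hh => hα ⟨h, hh⟩)
    ((hM _).2 ⟨Units.mk0 w hw0, hw, hwα⟩)
  obtain ⟨y, hy, hyx⟩ := (hN _).1 hxN
  exact ⟨x, y, x.ne_zero, y.ne_zero, fun h => hx h h.2, hy, hyx⟩

end NormCriterion

section Heisenberg

theorem AddChar.map_sum_eq_prod {A M ι : Type*} [AddCommMonoid A] [CommMonoid M] (ψ : AddChar A M)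
    (f : ι → A) (t : Finset ι) : ψ (∑ i ∈ t, f i) = ∏ i ∈ t, ψ (f i) := by
  classical
  induction t using Finset.induction_on with
  | empty => simp
  | insert i t hi ih => rw [Finset.sum_insert hi, Finset.prod_insert hi, ψ.map_add_eq_mul, ih]

theorem ZMod.prod_val_eq_prod_range {M : Type*} [CommMonoid M] (n : ℕ) [NeZero n] (f : ℕ → M) :
    ∏ i : ZMod n, f i.val = ∏ i ∈ Finset.range n, f i := by
  obtain ⟨k, rfl⟩ := Nat.exists_eq_succ_of_ne_zero (NeZero.ne n)
  exact (Finset.prod_range f).symm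

variable {F Ω : Type*} [Field F] [Field Ω] [Algebra F Ω]
variable {p : ℕ} [Fact p.Prime] {H : Subgroup (Ω ≃ₐ[F] Ω)}

local notation "π" => ZMod.castHom (dvd_pow_self p two_ne_zero) (ZMod p)

theorem map_pow_of_cocycle {G : Type*} [Group G] {p : ℕ} {a b c : G → ZMod p}
    (ha : ∀ g h, a (g * h) = a g + a h) (hc : ∀ g h, c (g * h) = c g + c h + a g * b h)
    {s : G} (hs : b s = 1) (h1 : b 1 = 0) (k : ℕ) :
    c (s ^ k) = k * c s + k.choose 2 * a s := by
  induction k with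
  | zero => simpa [h1] using hc 1 1
  | succ k ih =>
    rw [pow_succ, hc, ih, map_pow_of_additive ha, hs, Nat.choose_succ_succ' k 1, Nat.choose_one_right]
    push_cast
    ring

theorem natCast_choose_two_eq_zero (hodd : p ≠ 2) : ((p.choose 2 : ℕ) : ZMod p) = 0 := by
  have hp : p.Prime := Fact.out
  rw [ZMod.natCast_eq_zero_iff]
  exact hp.dvd_choose_self two_ne_zero (lt_of_le_of_ne hp.two_le hodd.symm)

/-- Given a continuous homomorphism to the Heisenberg group over `ZMod p` with entries `a`, `b`, `c`
whose component `b` is nonzero, the Kummer class of `a` is a norm from the extension cut out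
by `b`. -/
theorem exists_norm_eq_kummer_pow [IsGalois F Ω] (hodd : p ≠ 2) (ψ : AddChar (ZMod p) F)
    (hH : IsOpen (H : Set (Ω ≃ₐ[F] Ω))) {a b c : H → ZMod p}
    (ha : ∀ g h, a (g * h) = a g + a h) (hb : ∀ g h, b (g * h) = b g + b h)
    (hc : ∀ g h, c (g * h) = c g + c h + a g * b h)
    (hbl : IsLocallyConstant b) (hcl : IsLocallyConstant c) {s : H} (hs : b s = 1)
    {u : Ω} (hu0 : u ≠ 0) (hu : ∀ h : H, h.1 u = algebraMap F Ω (ψ (a h)) * u) :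
    ∃ w : Ω, w ≠ 0 ∧ (∀ h : H, b h = 0 → h.1 w = w) ∧
      ∏ i ∈ Finset.range p, (s.1 ^ i) w = u ^ p := by
  have hle : H.kerOf b hb ≤ H := fun g hg => (Subgroup.mem_kerOf.1 hg).1
  have hbz : ∀ g : H.kerOf b hb, b ⟨g, hle g.2⟩ = 0 := fun g => (Subgroup.mem_kerOf.1 g.2).2
  obtain ⟨v, hv0, hv⟩ := exists_kummer_generator ψ (Subgroup.isOpen_kerOf hH hb hbl)
    (χ := fun g => c ⟨g, hle g.2⟩)
    (fun g h => by
      have := hc ⟨g, hle g.2⟩ ⟨h, hle h.2⟩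
      rwa [hbz, mul_zero, add_zero] at this)
    (hcl.comp_continuous (continuous_subtype_val.subtype_mk fun g => hle g.2))
  replace hv : ∀ h : H, b h = 0 → h.1 v = algebraMap F Ω (ψ (c h)) * v := fun h hh =>
    hv ⟨h, Subgroup.mem_kerOf.2 ⟨h.2, hh⟩⟩
  have hsv0 : s.1 v ≠ 0 := (map_ne_zero _).2 hv0
  have hψ0 : ∀ i, algebraMap F Ω (ψ i) ≠ 0 := ψ.algebraMap_ne_zero
  refine ⟨algebraMap F Ω (ψ (c s)) * u * (v / s.1 v),
    mul_ne_zero (mul_ne_zero (hψ0 _) hu0) (div_ne_zero hv0 hsv0), fun h hh => ?_, ?_⟩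
  · have hbk : b (s⁻¹ * (h * s)) = 0 := by
      rw [hb, hb, hh, map_inv_of_additive hb, zero_add, neg_add_cancel]
    have hck : c (s⁻¹ * (h * s)) = c h + a h := by
      have h1 := hc s (s⁻¹ * (h * s))
      rw [mul_inv_cancel_left, hc, hbk, hs] at h1
      linear_combination -h1
    have hsv : h.1 (s.1 v) = algebraMap F Ω (ψ (c h)) * algebraMap F Ω (ψ (a h)) * s.1 v := by
      have h1 := congrArg s.1 (hv _ hbk)
      rw [hck, map_mul, AlgEquiv.commutes, ψ.map_add_eq_mul, map_mul] at h1
      rw [← h1, ← AlgEquiv.mul_apply, ← AlgEquiv.mul_apply, ← Subgroup.coe_mul, ← Subgroup.coe_mul,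
        mul_inv_cancel_left]
    rw [map_mul, map_mul, map_div₀, hsv, AlgEquiv.commutes, hu, hv h hh]
    have := hψ0 (c h)
    have := hψ0 (a h)
    field_simp
  · have hb1 : b 1 = 0 := by simpa using hb 1 1
    have hsu : ∀ i : ℕ, (s.1 ^ i) u = algebraMap F Ω (ψ (i * a s)) * u := fun i => by
      rw [← map_pow_of_additive ha, ← hu, Subgroup.coe_pow]
    have hsp : (s.1 ^ p) v = v := by
      have h1 := hv (s ^ p) (by rw [map_pow_of_additive hb, CharP.cast_eq_zero, zero_mul])
      rwa [map_pow_of_cocycle ha hc hs hb1, CharP.cast_eq_zero, natCast_choose_two_eq_zero hodd,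
        zero_mul, zero_mul, add_zero, ψ.map_zero_eq_one, map_one, one_mul] at h1
    have h1 : ∏ i ∈ Finset.range p, (s.1 ^ i) (v / s.1 v) = 1 := by
      have := prod_pow_mul_map s.1 p hv0
      rw [hsp] at this
      exact mul_right_cancel₀ hv0 (this.trans (one_mul v).symm)
    have h2 : ∏ i ∈ Finset.range p, algebraMap F Ω (ψ (i * a s)) = 1 := by
      rw [← map_prod, ← ψ.map_sum_eq_prod, ← Finset.sum_mul, ← Nat.cast_sum,
        Finset.sum_range_id, ← Nat.choose_two_right, natCast_choose_two_eq_zero hodd, zero_mul,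
        ψ.map_zero_eq_one, map_one]
    have h3 : algebraMap F Ω (ψ (c s)) ^ p = 1 := by
      rw [← map_pow, ← ψ.map_nsmul_eq_pow, nsmul_eq_mul, CharP.cast_eq_zero, zero_mul,
        ψ.map_zero_eq_one, map_one]
    simp only [map_mul, AlgEquiv.commutes, hsu]
    rw [Finset.prod_mul_distrib, Finset.prod_mul_distrib, Finset.prod_mul_distrib, h1, h2]
    simp only [Finset.prod_const, Finset.card_range, h3, one_mul, mul_one]

theorem isLocallyConstant_sum {X ι A : Type*} [TopologicalSpace X] [AddCommMonoid A]
    {f : ι → X → A} (hf : ∀ i, IsLocallyConstant (f i)) (t : Finset ι) :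
    IsLocallyConstant fun x => ∑ i ∈ t, f i x := by
  classical
  induction t using Finset.induction_on with
  | empty =>
    simp only [Finset.sum_empty]
    exact IsLocallyConstant.const 0
  | insert i t hi ih =>
    simp only [Finset.sum_insert hi]
    exact (hf i).add ih

/-- A continuous homomorphism to the Heisenberg group over `ZMod p`, given by its entries, lifts to
the Heisenberg group over `ZMod (p ^ 2)`, in the case where the entry `b` is nonzero. -/
theorem exists_heisenberg_lift_of_eq_one (l : ℕ) [Fact l.Prime] [Algebra ℚ_[l] F]
    [FiniteDimensional ℚ_[l] F] [IsGalois F Ω] [IsSepClosed Ω] [CharZero Ω] (hodd : p ≠ 2)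
    (Ψ : AddChar (ZMod (p ^ 2)) F) (hΨ : Function.Injective Ψ)
    (ψ : AddChar (ZMod p) F) (hψ : Function.Injective ψ) (hΨψ : ∀ X, Ψ X ^ p = ψ (π X))
    (hH : IsOpen (H : Set (Ω ≃ₐ[F] Ω))) {a c : H → ZMod p} {B : H → ZMod (p ^ 2)}
    (ha : ∀ g h, a (g * h) = a g + a h) (hB : ∀ g h, B (g * h) = B g + B h)
    (hc : ∀ g h, c (g * h) = c g + c h + a g * π (B h))
    (hal : IsLocallyConstant a) (hBl : IsLocallyConstant B) (hcl : IsLocallyConstant c)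
    {s : H} (hs : B s = 1) :
    ∃ A C : H → ZMod (p ^ 2), (∀ g h, A (g * h) = A g + A h) ∧
      (∀ g h, C (g * h) = C g + C h + A g * B h) ∧
      IsLocallyConstant A ∧ IsLocallyConstant C ∧ (∀ h, π (A h) = a h) ∧ ∀ h, π (C h) = c h := by
  have hp0 : p ≠ 0 := (Fact.out : p.Prime).ne_zero
  have hn0 : p ^ 2 ≠ 0 := pow_ne_zero _ hp0
  have : NeZero (p ^ 2) := ⟨hn0⟩
  have : NeZero ((p ^ 2 : ℕ) : Ω) := ⟨by exact_mod_cast hn0⟩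
  obtain ⟨u, hu0, hu⟩ := exists_kummer_generator ψ hH ha hal
  have hbl : IsLocallyConstant fun h => π (B h) := hBl.comp _
  obtain ⟨w, hw0, hw, hwu⟩ := exists_norm_eq_kummer_pow hodd ψ hH ha
    (fun g h => by rw [hB, map_add]) hc hbl hcl (s := s) (by rw [hs, map_one]) hu0 hu
  have hroot : ∀ i, algebraMap F Ω (ψ i) ^ p = 1 := fun i => by
    rw [← map_pow, ← ψ.map_nsmul_eq_pow, nsmul_eq_mul, CharP.cast_eq_zero, zero_mul,
        ψ.map_zero_eq_one, map_one]
  obtain ⟨x, y, hx0, hy0, hx, hy, hxy⟩ := exists_norm_eq_mul_pow l hH hB hBl hs hw0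
    (fun h => by rw [map_pow, hu, mul_pow, hroot, one_mul]) hw hwu
  have hY : ∀ i : ZMod (p ^ 2), ∃ Y : Ω, Y ^ (p ^ 2) = (s.1 ^ i.val) y := fun i =>
    IsSepClosed.exists_pow_nat_eq _ _
  choose Y hY using hY
  have hY0 : ∀ i, Y i ≠ 0 := fun i h => by
    have h1 := hY i
    rw [h, zero_pow hn0] at h1
    exact (map_ne_zero _).2 hy0 h1.symm
  have hmove : ∀ (h : H) i, h.1 ((s.1 ^ i.val) y) = (s.1 ^ (i + B h).val) y := by
    intro h i
    have h1 := apply_eq_pow_apply hB hs hy (h * s ^ i.val)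
    rw [hB, map_pow_of_additive hB, hs, mul_one, ZMod.natCast_zmod_val, add_comm] at h1
    rw [← h1]
    rfl
  have he : ∀ (h : H) i, ∃ j, algebraMap F Ω (Ψ j) * Y (i + B h) = h.1 (Y i) := by
    intro h i
    obtain ⟨j, hj⟩ := Ψ.exists_eq_of_pow_eq_one hΨ (x := h.1 (Y i) / Y (i + B h)) (by
      rw [div_pow, ← map_pow, hY, hY, hmove, div_self]
      exact (map_ne_zero _).2 hy0)
    exact ⟨j, by rw [hj, div_mul_cancel₀ _ (hY0 _)]⟩
  choose e he using he
  have hemul : ∀ g h i, e (g * h) i = e h i + e g (i + B h) := by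
    intro g h i
    apply Ψ.algebraMap_mul_injective hΨ (hY0 (i + B (g * h)))
    dsimp only
    rw [he, Subgroup.coe_mul, AlgEquiv.mul_apply, ← he h, map_mul, AlgEquiv.commutes, ← he g,
      Ψ.map_add_eq_mul, map_mul, hB, add_comm (B g), add_assoc, mul_assoc]
  have hel : ∀ i, IsLocallyConstant fun h => e h i := by
    intro i
    have h1 : IsLocallyConstant fun h => (e h i, B h) := by
      refine IsLocallyConstant.desc _ (fun q => (algebraMap F Ω (Ψ q.1) * Y (i + q.2), q.2)) ?_ ?_
      · convert ((isLocallyConstant_galois_apply (F := F) (Y i)).comp_continuous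
          (continuous_subtype_val (p := (· ∈ H)))).prodMk hBl using 1
        funext h
        exact Prod.ext (he h i) rfl
      · rintro ⟨i₁, j₁⟩ ⟨i₂, j₂⟩ h
        obtain ⟨h1, rfl⟩ := Prod.mk.inj h
        exact Prod.ext (Ψ.algebraMap_mul_injective hΨ (hY0 _) h1) rfl
    exact h1.comp Prod.fst
  let A : H → ZMod (p ^ 2) := fun h => ∑ i, e h i
  let C₀ : H → ZMod (p ^ 2) := fun h => -∑ i, i * e h i
  have hshift : ∀ (h : H) (f : ZMod (p ^ 2) → ZMod (p ^ 2)), ∑ i, f (i + B h) = ∑ i, f i :=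
    fun h f => Equiv.sum_comp (Equiv.addRight (B h)) f
  have hA : ∀ g h, A (g * h) = A g + A h := by
    intro g h
    simp only [A, hemul, Finset.sum_add_distrib]
    rw [hshift h (e g), add_comm]
  have hC₀ : ∀ g h, C₀ (g * h) = C₀ g + C₀ h + A g * B h := by
    intro g h
    have h1 := hshift h fun i => (i - B h) * e g i
    simp only [add_sub_cancel_right] at h1
    simp only [A, C₀, hemul, mul_add, Finset.sum_add_distrib, h1, sub_mul,
      Finset.sum_sub_distrib, ← Finset.mul_sum]
    ring
  have hAl : IsLocallyConstant A := isLocallyConstant_sum hel _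
  have hC₀l : IsLocallyConstant C₀ :=
    (isLocallyConstant_sum (fun i => (hel i).comp fun j => i * j) _).neg
  set P := ∏ i, Y i with hP
  have hP0 : P ≠ 0 := Finset.prod_ne_zero_iff.2 fun i _ => hY0 i
  have hPmap : ∀ h : H, h.1 P = algebraMap F Ω (Ψ (A h)) * P := by
    intro h
    rw [hP, map_prod, Ψ.map_sum_eq_prod, map_prod, ← Equiv.prod_comp (Equiv.addRight (B h)) Y,
      ← Finset.prod_mul_distrib]
    exact Finset.prod_congr rfl fun i _ => (he h i).symm
  have hPpow : (P ^ p) ^ p = (u * x) ^ p := by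
    rw [← pow_mul, ← pow_two, hP, ← Finset.prod_pow, mul_pow, ← hxy,
      ← ZMod.prod_val_eq_prod_range (p ^ 2) fun i => (s.1 ^ i) y]
    exact Finset.prod_congr rfl fun i _ => hY i
  have hux : u * x ≠ 0 := mul_ne_zero hu0 hx0
  obtain ⟨j, hj⟩ := ψ.exists_eq_of_pow_eq_one hψ (x := P ^ p / (u * x)) (by
    rw [div_pow, hPpow, div_self (pow_ne_zero _ hux)])
  have hAa : ∀ h, π (A h) = a h := by
    intro h
    apply ψ.algebraMap_mul_injective hψ (pow_ne_zero p hP0)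
    dsimp only
    rw [← hΨψ, map_pow, ← mul_pow, ← hPmap, ← map_pow]
    rw [eq_div_iff hux] at hj
    rw [← hj, map_mul, map_mul, AlgEquiv.commutes, hu, hx]
    ring
  obtain ⟨D, hD, hDl, hDc⟩ := exists_character_lift Ψ hΨ ψ hψ hΨψ hH
    (χ := fun h => π (C₀ h) - c h)
    (fun g h => by rw [hC₀, map_add, map_add, map_mul, hAa, hc]; ring)
    ((hC₀l.comp _).sub hcl)
  refine ⟨A, fun h => C₀ h - D h, hA, fun g h => ?_, hAl, hC₀l.sub hDl, hAa, fun h => ?_⟩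
  · dsimp only
    rw [hC₀, hD]
    ring
  · dsimp only
    rw [map_sub, hDc, sub_sub_cancel]

/-- A continuous homomorphism from an open subgroup of the Galois group of a local field to the
Heisenberg group over `ZMod p`, given by its entries, lifts to the Heisenberg group over
`ZMod (p ^ 2)`. -/
theorem exists_heisenberg_lift (l : ℕ) [Fact l.Prime] [Algebra ℚ_[l] F]
    [FiniteDimensional ℚ_[l] F] [IsGalois F Ω] [IsSepClosed Ω] [CharZero Ω] (hodd : p ≠ 2)
    (Ψ : AddChar (ZMod (p ^ 2)) F) (hΨ : Function.Injective Ψ)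
    (ψ : AddChar (ZMod p) F) (hψ : Function.Injective ψ) (hΨψ : ∀ X, Ψ X ^ p = ψ (π X))
    (hH : IsOpen (H : Set (Ω ≃ₐ[F] Ω))) {a b c : H → ZMod p}
    (ha : ∀ g h, a (g * h) = a g + a h) (hb : ∀ g h, b (g * h) = b g + b h)
    (hc : ∀ g h, c (g * h) = c g + c h + a g * b h)
    (hal : IsLocallyConstant a) (hbl : IsLocallyConstant b) (hcl : IsLocallyConstant c) :
    ∃ A B C : H → ZMod (p ^ 2), (∀ g h, A (g * h) = A g + A h) ∧
      (∀ g h, B (g * h) = B g + B h) ∧ (∀ g h, C (g * h) = C g + C h + A g * B h) ∧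
      IsLocallyConstant A ∧ IsLocallyConstant B ∧ IsLocallyConstant C ∧
      (∀ h, π (A h) = a h) ∧ (∀ h, π (B h) = b h) ∧ ∀ h, π (C h) = c h := by
  by_cases h0 : ∀ h, b h = 0
  · obtain ⟨A, hA, hAl, hAa⟩ := exists_character_lift Ψ hΨ ψ hψ hΨψ hH ha hal
    obtain ⟨C, hC, hCl, hCc⟩ := exists_character_lift Ψ hΨ ψ hψ hΨψ hH (χ := c)
      (fun g h => by rw [hc, h0, mul_zero, add_zero]) hcl
    exact ⟨A, fun _ => 0, C, hA, fun _ _ => (add_zero 0).symm,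
      fun g h => by rw [hC, mul_zero, add_zero], hAl, IsLocallyConstant.const 0, hCl, hAa,
      fun h => by rw [map_zero, h0], hCc⟩
  · push Not at h0
    obtain ⟨g, hg⟩ := h0
    obtain ⟨B, hB, hBl, hBb⟩ := exists_character_lift Ψ hΨ ψ hψ hΨψ hH hb hbl
    obtain ⟨s, hs⟩ : ∃ s, B s = 1 := by
      have hp : p.Prime := Fact.out
      have : NeZero (p ^ 2) := ⟨pow_ne_zero _ hp.ne_zero⟩
      have h1 : IsUnit (B g) := by
        rw [← ZMod.natCast_zmod_val (B g), ZMod.isUnit_iff_coprime]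
        refine (Nat.Coprime.pow_left 2 ((hp.coprime_iff_not_dvd).2 ?_)).symm
        rwa [← castHom_eq_zero_iff, hBb]
      obtain ⟨k, hk⟩ := h1.exists_left_inv
      exact ⟨g ^ k.val, by rw [map_pow_of_additive hB, ZMod.natCast_zmod_val, hk]⟩
    obtain ⟨A, C, hA, hC, hAl, hCl, hAa, hCc⟩ := exists_heisenberg_lift_of_eq_one l hodd Ψ hΨ ψ hψ
      hΨψ hH ha hB (fun g h => by rw [hBb, hc]) hal hBl hcl hs
    exact ⟨A, B, C, hA, hB, hC, hAl, hBl, hCl, hAa, hBb, hCc⟩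

end Heisenberg

section Averaging

/-- Averaging a cocycle with values in a ring over a finite set, when all its values agree modulo an
ideal of square zero, yields a homomorphism. -/
theorem exists_monoidHom_of_cocycle {G Q R M M' : Type*} [Group G] [Fintype Q] [Nonempty Q]
    [MulAction G Q] [CommRing R] [Ring M] [Algebra R M] [Ring M'] (φ : M →+* M')
    (hφ : ∀ x y, φ x = 0 → φ y = 0 → x * y = 0) (hQ : IsUnit (Fintype.card Q : R))
    (f : G → Q → M) (hmul : ∀ g g' q, f (g * g') q = f g (g' • q) * f g' q)
    (hone : ∀ q, f 1 q = 1) {r : G → M'} (hr : ∀ g q, φ (f g q) = r g) :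
    ∃ F : G →* M, (∀ g, φ (F g) = r g) ∧ ∀ g, (∀ q, f g q = 1) → F g = 1 := by
  obtain ⟨n, hn⟩ := hQ.exists_left_inv
  have hconst : ∀ x : M, n • ∑ _q : Q, x = x := fun x => by
    rw [Finset.sum_const, Finset.card_univ, ← Nat.cast_smul_eq_nsmul R, smul_smul, hn, one_smul]
  set F : G → M := fun g => n • ∑ q, f g q with hF
  have hF1 : ∀ g, (∀ q, f g q = 1) → F g = 1 := fun g hg => by
    simp only [hF, hg, hconst]
  have hφF : ∀ g q, φ (f g q - F g) = 0 := by
    intro g q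
    have h1 : f g q - F g = n • ∑ q', (f g q - f g q') := by
      rw [Finset.sum_sub_distrib, smul_sub, hconst]
    rw [h1, Algebra.smul_def, map_mul, map_sum]
    simp [hr]
  have hsum : ∀ g, ∑ q, (f g q - F g) = 0 := fun g => by
    rw [Finset.sum_sub_distrib, sub_eq_zero]
    simp only [hF]
    rw [← Finset.smul_sum, hconst]
  refine ⟨⟨⟨F, hF1 1 hone⟩, fun g g' => ?_⟩, fun g => ?_, hF1⟩
  · have hsum' : ∑ q, (f g (g' • q) - F g) = 0 :=
      (Equiv.sum_comp (MulAction.toPerm g') fun q => f g q - F g).trans (hsum g)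
    have h1 : ∀ q, f (g * g') q =
        F g * F g' + F g * (f g' q - F g') + (f g (g' • q) - F g) * F g' := fun q => by
      rw [hmul, ← sub_eq_zero, ← hφ _ _ (hφF g (g' • q)) (hφF g' q)]
      noncomm_ring
    change n • ∑ q, f (g * g') q = F g * F g'
    simp only [h1, Finset.sum_add_distrib]
    rw [← Finset.mul_sum, ← Finset.mul_sum, ← Finset.sum_mul, hsum, hsum', mul_zero, zero_mul,
      add_zero, add_zero, ← mul_smul_comm, hconst]
  · obtain ⟨q⟩ := ‹Nonempty Q›
    change φ (F g) = r g
    rw [← hr g q, eq_comm, ← sub_eq_zero, ← map_sub, hφF]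

/-- A homomorphism to `Mˣ` lifting on a subgroup of finite index invertible in `R` along a
ring homomorphism whose kernel has square zero, lifts on the whole group. -/
theorem exists_lift_of_lift_subgroup {G R M M' : Type*} [Group G] [CommRing R] [Ring M]
    [Algebra R M] [Ring M'] (φ : M →+* M') (hφ : ∀ x y, φ x = 0 → φ y = 0 → x * y = 0)
    (hsurj : Function.Surjective (Units.map (φ : M →* M'))) (H : Subgroup G) [H.FiniteIndex]
    (hH : IsUnit (H.index : R)) (ρ : G →* M'ˣ) (τ : H →* Mˣ)
    (hτ : ∀ h : H, Units.map (φ : M →* M') (τ h) = ρ h) :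
    ∃ ρ₂ : G →* Mˣ, (∀ g, Units.map (φ : M →* M') (ρ₂ g) = ρ g) ∧
      ∀ g, (∀ q : G ⧸ H, ∃ h : H, q.out⁻¹ * g * q.out = h ∧ τ h = 1) → ρ₂ g = 1 := by
  classical
  have : Fintype (G ⧸ H) := Fintype.ofFinite _
  choose L hL using hsurj
  have ht : ∀ x : G, (x : G ⧸ H).out⁻¹ * x ∈ H := fun x =>
    QuotientGroup.eq.1 (QuotientGroup.out_eq' (x : G ⧸ H))
  let t : G → H := fun x => ⟨(x : G ⧸ H).out⁻¹ * x, ht x⟩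
  have htmul : ∀ x (h : H), t (x * h) = t x * h := fun x h => by
    apply Subtype.ext
    simp only [t, Subgroup.coe_mul, QuotientGroup.mk_mul_of_mem x h.2, mul_assoc]
  let s : G → Mˣ := fun x => L (ρ (x : G ⧸ H).out) * τ (t x)
  have hsmul : ∀ x (h : H), s (x * h) = s x * τ h := fun x h => by
    simp only [s, htmul, map_mul, QuotientGroup.mk_mul_of_mem x h.2, mul_assoc]
  have hsρ : ∀ x, Units.map (φ : M →* M') (s x) = ρ x := fun x => by
    simp only [s, map_mul, map_inv, hL, hτ, t, mul_inv_cancel_left]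
  have hinv : ∀ g x (h : H), s (g * (x * h)) * (s (x * h))⁻¹ = s (g * x) * (s x)⁻¹ := by
    intro g x h
    rw [← mul_assoc, hsmul, hsmul]
    group
  obtain ⟨F, hF, hF1⟩ := exists_monoidHom_of_cocycle (G := G) (Q := G ⧸ H) (R := R) φ hφ
    (by rwa [← Nat.card_eq_fintype_card, ← Subgroup.index_eq_card])
    (fun g q => ((s (g * q.out) * (s q.out)⁻¹ : Mˣ) : M)) (fun g g' q => by
      have h2 : ((g' * q.out : G) : G ⧸ H) = g' • q := by
        conv_rhs => rw [← QuotientGroup.out_eq' q]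
        rfl
      have h1 : g' * q.out * ((t (g' * q.out))⁻¹ : H) = (g' • q).out := by
        simp only [t, Subgroup.coe_inv, h2]
        group
      have h3 := hinv g (g' * q.out) (t (g' * q.out))⁻¹
      rw [h1] at h3
      rw [h3, ← Units.val_mul, ← mul_assoc]
      group)
    (fun q => by rw [one_mul, mul_inv_cancel, Units.val_one]) (r := fun g => (ρ g : M'))
    (fun g q => by
      have h1 : Units.map (φ : M →* M') (s (g * q.out) * (s q.out)⁻¹) = ρ g := by
        rw [map_mul, map_inv, hsρ, hsρ, map_mul, mul_inv_cancel_right]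
      exact congrArg Units.val h1)
  refine ⟨F.toHomUnits, fun g => Units.ext (hF g), fun g hg => Units.ext (hF1 g fun q => ?_)⟩
  obtain ⟨h, hh, hh1⟩ := hg q
  have h1 : g * q.out = q.out * h := by rw [← hh]; group
  rw [h1, hsmul, hh1, mul_one, mul_inv_cancel, Units.val_one]

theorem exists_not_dvd_index_of_not_dvd_index {G K : Type*} [Group G] [Group K] {p : ℕ}
    (ρ : G →* K) (U : Subgroup K) [U.FiniteIndex] (hU : ¬ p ∣ U.index) :
    ∃ (k : K) (H : Subgroup G), (∀ g, g ∈ H ↔ k⁻¹ * ρ g * k ∈ U) ∧ ¬ p ∣ H.index := by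
  let _ : MulAction G (K ⧸ U) := MulAction.compHom _ ρ
  have hact : ∀ (g : G) (x : K), g • (x : K ⧸ U) = ((ρ g * x : K) : K ⧸ U) := fun _ _ => rfl
  by_contra! hcon
  refine hU ?_
  classical
  have : Fintype (MulAction.orbitRel.Quotient G (K ⧸ U)) := Fintype.ofFinite _
  rw [Subgroup.index_eq_card, Nat.card_congr (MulAction.selfEquivSigmaOrbits G (K ⧸ U)),
    Nat.card_sigma]
  refine Finset.dvd_sum fun ω _ => ?_
  obtain ⟨k, hk⟩ := QuotientGroup.mk_surjective ω.out
  have := hcon k (MulAction.stabilizer G ω.out) fun g => by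
    rw [MulAction.mem_stabilizer_iff, ← hk, hact, eq_comm, QuotientGroup.eq, mul_assoc]
  rwa [MulAction.index_stabilizer] at this

end Averaging

section Matrices

theorem Units.map_surjective_of_sq_zero {M M' : Type*} [Ring M] [Ring M'] (φ : M →+* M')
    (hsurj : Function.Surjective φ) (hφ : ∀ x y, φ x = 0 → φ y = 0 → x * y = 0) :
    Function.Surjective (Units.map (φ : M →* M')) := by
  intro u
  obtain ⟨x, hx⟩ := hsurj u
  obtain ⟨y, hy⟩ := hsurj (u⁻¹ : M'ˣ)
  have h1 : (x * y - 1) * (x * y - 1) = 0 := hφ _ _ (by simp [hx, hy]) (by simp [hx, hy])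
  have h2 : (y * x - 1) * (y * x - 1) = 0 := hφ _ _ (by simp [hx, hy]) (by simp [hx, hy])
  have h3 : x * (y * (2 - x * y)) = 1 := by
    rw [← sub_eq_zero, ← neg_eq_zero, ← h1]
    noncomm_ring
  have h4 : (2 - y * x) * y * x = 1 := by
    rw [← sub_eq_zero, ← neg_eq_zero, ← h2]
    noncomm_ring
  refine ⟨⟨x, y * (2 - x * y), h3, ?_⟩, Units.ext hx⟩
  rwa [← left_inv_eq_right_inv h4 h3]

theorem Matrix.mul_eq_zero_of_map_eq_zero {n R S : Type*} [Fintype n] [DecidableEq n] [CommRing R]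
    [CommRing S] (φ : R →+* S) (hφ : ∀ x y, φ x = 0 → φ y = 0 → x * y = 0) (x y : Matrix n n R)
    (hx : φ.mapMatrix x = 0) (hy : φ.mapMatrix y = 0) : x * y = 0 := by
  ext i j
  rw [Matrix.mul_apply]
  exact Finset.sum_eq_zero fun k _ => hφ _ _ (congrFun₂ hx i k) (congrFun₂ hy k j)

variable {R S : Type} [CommRing R] [CommRing S]

/-- The upper unitriangular matrix with entries `a`, `b` above the diagonal and `c` in the corner. -/
def heisenberg (a b c : R) : GL (Fin 3) R where
  val := !![1, a, c; 0, 1, b; 0, 0, 1]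
  inv := !![1, -a, a * b - c; 0, 1, -b; 0, 0, 1]
  val_inv := by
    ext i j
    fin_cases i <;> fin_cases j <;> simp [Matrix.mul_apply, Fin.sum_univ_three]
    ring
  inv_val := by
    ext i j
    fin_cases i <;> fin_cases j <;> simp [Matrix.mul_apply, Fin.sum_univ_three]
    ring

theorem heisenberg_mul (a b c a' b' c' : R) :
    heisenberg a b c * heisenberg a' b' c' = heisenberg (a + a') (b + b') (c + c' + a * b') := by
  ext i j
  fin_cases i <;> fin_cases j <;> simp [heisenberg, Matrix.mul_apply, Fin.sum_univ_three] <;> ring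

theorem heisenberg_zero : heisenberg (0 : R) 0 0 = 1 := by
  ext i j
  fin_cases i <;> fin_cases j <;> simp [heisenberg]

theorem map_heisenberg (φ : R →+* S) (a b c : R) :
    Matrix.GeneralLinearGroup.map φ (heisenberg a b c) = heisenberg (φ a) (φ b) (φ c) := by
  ext i j
  fin_cases i <;> fin_cases j <;> simp [heisenberg]

theorem isUniTri_heisenberg (a b c : R) : IsUniTri (heisenberg a b c) := by
  refine ⟨fun i j hij => ?_, fun i => ?_⟩
  · fin_cases i <;> fin_cases j <;> first | exact absurd hij (by decide) | rfl
  · fin_cases i <;> rfl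

theorem IsUniTri.eq_heisenberg {g : GL (Fin 3) R} (hg : IsUniTri g) :
    g = heisenberg (g 0 1) (g 1 2) (g 0 2) := by
  ext i j
  fin_cases i <;> fin_cases j <;>
    simp [heisenberg, hg.2, hg.1 1 0 (by decide), hg.1 2 0 (by decide), hg.1 2 1 (by decide)]

theorem heisenberg_injective {a b c a' b' c' : R} (h : heisenberg a b c = heisenberg a' b' c') :
    a = a' ∧ b = b' ∧ c = c' := by
  have h1 : ∀ i j, (heisenberg a b c) i j = (heisenberg a' b' c') i j := fun i j => by rw [h]
  exact ⟨h1 0 1, h1 1 2, h1 0 2⟩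

variable (R) in
/-- The subgroup of upper unitriangular matrices in `GL (Fin 3) R`. -/
def uniTriSubgroup : Subgroup (GL (Fin 3) R) where
  carrier := {g | IsUniTri g}
  one_mem' := heisenberg_zero (R := R) ▸ isUniTri_heisenberg 0 0 0
  mul_mem' {g h} hg hh := by
    rw [Set.mem_ofPred_eq, IsUniTri.eq_heisenberg hg, IsUniTri.eq_heisenberg hh, heisenberg_mul]
    exact isUniTri_heisenberg _ _ _
  inv_mem' {g} hg := by
    have h1 : g⁻¹ = heisenberg (-g 0 1) (-g 1 2) (g 0 1 * g 1 2 - g 0 2) := by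
      rw [inv_eq_iff_mul_eq_one]
      nth_rw 1 [IsUniTri.eq_heisenberg hg]
      rw [heisenberg_mul, ← heisenberg_zero]
      congr 1 <;> ring
    rw [Set.mem_ofPred_eq, h1]
    exact isUniTri_heisenberg _ _ _

theorem mem_uniTriSubgroup {g : GL (Fin 3) R} : g ∈ uniTriSubgroup R ↔ IsUniTri g := Iff.rfl

variable (R) in
theorem card_uniTriSubgroup : Nat.card (uniTriSubgroup R) = Nat.card R ^ 3 := by
  let e : R × R × R ≃ uniTriSubgroup R :=
    Equiv.ofBijective (fun q => ⟨heisenberg q.1 q.2.1 q.2.2, isUniTri_heisenberg _ _ _⟩)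
      ⟨fun q q' h => by
        obtain ⟨h1, h2, h3⟩ := heisenberg_injective (congrArg Subtype.val h)
        exact Prod.ext h1 (Prod.ext h2 h3),
      fun g => ⟨(g.1 0 1, g.1 1 2, g.1 0 2), Subtype.ext (IsUniTri.eq_heisenberg g.2).symm⟩⟩
  rw [← Nat.card_congr e, Nat.card_prod, Nat.card_prod]
  ring

theorem not_dvd_index_uniTriSubgroup (p : ℕ) [Fact p.Prime] :
    ¬ p ∣ (uniTriSubgroup (ZMod p)).index := by
  have hp : p.Prime := Fact.out
  have h1 := (uniTriSubgroup (ZMod p)).card_mul_index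
  rw [card_uniTriSubgroup, Nat.card_zmod, Matrix.card_GL_field, Fin.prod_univ_three, ZMod.card] at h1
  have h2 : (uniTriSubgroup (ZMod p)).index = (p ^ 3 - 1) * (p ^ 2 - 1) * (p - 1) := by
    apply Nat.eq_of_mul_eq_mul_left (pow_pos hp.pos 3)
    rw [h1]
    have h3 : p ^ 3 - p ^ 1 = p * (p ^ 2 - 1) := by rw [Nat.mul_sub]; ring_nf
    have h4 : p ^ 3 - p ^ 2 = p ^ 2 * (p - 1) := by rw [Nat.mul_sub]; ring_nf
    change (p ^ 3 - p ^ 0) * (p ^ 3 - p ^ 1) * (p ^ 3 - p ^ 2) = _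
    rw [h3, h4, pow_zero]
    ring
  have h3 : ∀ k, k ≠ 0 → ¬ p ∣ p ^ k - 1 := fun k hk h => by
    have := (Nat.dvd_sub_iff_right (Nat.one_le_pow _ _ hp.pos) (dvd_pow_self p hk)).1 h
    exact hp.one_lt.ne' (Nat.dvd_one.1 this)
  rw [h2, hp.dvd_mul, hp.dvd_mul]
  have := h3 1 one_ne_zero
  rw [pow_one] at this
  simp [h3, this]

end Matrices

section Lifting

theorem MonoidHom.isLocallyConstant_of_isOpen_ker {G M : Type*} [Group G] [TopologicalSpace G]
    [IsTopologicalGroup G] [Group M] (f : G →* M) (hf : IsOpen (f.ker : Set G)) :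
    IsLocallyConstant f := by
  refine (IsLocallyConstant.iff_exists_open _).2 fun x => ?_
  refine ⟨(fun y => x⁻¹ * y) ⁻¹' f.ker, hf.preimage (continuous_const_mul _), ?_, fun y hy => ?_⟩
  · simp
  · have h1 : f (x⁻¹ * y) = 1 := hy
    rw [map_mul, map_inv, inv_mul_eq_one] at h1
    exact h1.symm

/-- If `ζ` is a primitive `p ^ 2`-th root of unity, the characters attached to `ζ` and `ζ ^ p` are
compatible. -/
theorem exists_addChar_of_isPrimitiveRoot {F : Type*} [Field F] {p : ℕ} [Fact p.Prime] {ζ : F}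
    (hζ : IsPrimitiveRoot ζ (p ^ 2)) : ∃ (Ψ : AddChar (ZMod (p ^ 2)) F) (ψ : AddChar (ZMod p) F),
      Function.Injective Ψ ∧ Function.Injective ψ ∧
      ∀ X, Ψ X ^ p = ψ (ZMod.castHom (dvd_pow_self p two_ne_zero) (ZMod p) X) := by
  have hp : p.Prime := Fact.out
  have : NeZero (p ^ 2) := ⟨pow_ne_zero _ hp.ne_zero⟩
  have hζp : IsPrimitiveRoot (ζ ^ p) p := hζ.pow (pow_pos hp.pos 2) (pow_two p)
  have hinj : ∀ {n : ℕ} [NeZero n] {ξ : F} (hξ : IsPrimitiveRoot ξ n),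
      Function.Injective (AddChar.zmodChar n hξ.pow_eq_one) := by
    intro n _ ξ hξ i j hij
    rw [AddChar.zmodChar_apply, AddChar.zmodChar_apply] at hij
    exact ZMod.val_injective n (hξ.pow_inj (ZMod.val_lt i) (ZMod.val_lt j) hij)
  refine ⟨_, _, hinj hζ, hinj hζp, fun X => ?_⟩
  obtain ⟨k, rfl⟩ := ZMod.natCast_zmod_surjective X
  rw [map_natCast (ZMod.castHom _ (ZMod p)), AddChar.zmodChar_apply', AddChar.zmodChar_apply',
    ← pow_mul, ← pow_mul, mul_comm]

variable {F Ω : Type*} [Field F] [Field Ω] [Algebra F Ω] {p : ℕ} [Fact p.Prime]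

local notation "π" => ZMod.castHom (dvd_pow_self p two_ne_zero) (ZMod p)

/-- A continuous homomorphism from an open subgroup of the Galois group of a local field to
`U_3(ZMod p)` lifts to `U_3(ZMod (p ^ 2))`. -/
theorem exists_uniTri_lift (l : ℕ) [Fact l.Prime] [Algebra ℚ_[l] F] [FiniteDimensional ℚ_[l] F]
    [IsGalois F Ω] [IsSepClosed Ω] [CharZero Ω] (hodd : p ≠ 2) {ζ : F}
    (hζ : IsPrimitiveRoot ζ (p ^ 2)) {H : Subgroup (Ω ≃ₐ[F] Ω)}
    (hH : IsOpen (H : Set (Ω ≃ₐ[F] Ω))) (ρ : H →* GL (Fin 3) (ZMod p))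
    (hker : IsOpen (ρ.ker : Set H)) (hρ : ∀ h, IsUniTri (ρ h)) :
    ∃ τ : H →* GL (Fin 3) (ZMod (p ^ 2)), IsOpen (τ.ker : Set H) ∧ (∀ h, IsUniTri (τ h)) ∧
      ∀ h, Matrix.GeneralLinearGroup.map π (τ h) = ρ h := by
  obtain ⟨Ψ, ψ, hΨ, hψ, hΨψ⟩ := exists_addChar_of_isPrimitiveRoot hζ
  have hρl := ρ.isLocallyConstant_of_isOpen_ker hker
  have hmul : ∀ g h, heisenberg (ρ (g * h) 0 1) (ρ (g * h) 1 2) (ρ (g * h) 0 2) =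
      heisenberg (ρ g 0 1 + ρ h 0 1) (ρ g 1 2 + ρ h 1 2)
        (ρ g 0 2 + ρ h 0 2 + ρ g 0 1 * ρ h 1 2) := fun g h => by
    rw [← (hρ (g * h)).eq_heisenberg, ← heisenberg_mul, ← (hρ g).eq_heisenberg,
      ← (hρ h).eq_heisenberg, map_mul]
  obtain ⟨A, B, C, hA, hB, hC, hAl, hBl, hCl, hAa, hBb, hCc⟩ := exists_heisenberg_lift l hodd Ψ hΨ
    ψ hψ hΨψ hH (a := fun h => ρ h 0 1) (b := fun h => ρ h 1 2) (c := fun h => ρ h 0 2)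
    (fun g h => (heisenberg_injective (hmul g h)).1)
    (fun g h => (heisenberg_injective (hmul g h)).2.1)
    (fun g h => (heisenberg_injective (hmul g h)).2.2)
    (hρl.comp fun m => m 0 1) (hρl.comp fun m => m 1 2) (hρl.comp fun m => m 0 2)
  let τ : H →* GL (Fin 3) (ZMod (p ^ 2)) := MonoidHom.mk' (fun h => heisenberg (A h) (B h) (C h))
    fun g h => by rw [heisenberg_mul, hA, hB, hC]
  have hτl : IsLocallyConstant τ :=
    (hAl.prodMk (hBl.prodMk hCl)).comp fun q => heisenberg q.1 q.2.1 q.2.2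
  refine ⟨τ, hτl.isOpen_fiber 1, fun h => isUniTri_heisenberg _ _ _, fun h => ?_⟩
  change Matrix.GeneralLinearGroup.map π (heisenberg (A h) (B h) (C h)) = ρ h
  rw [map_heisenberg, hAa, hBb, hCc, ← (hρ h).eq_heisenberg]

theorem mul_eq_zero_of_castHom_eq_zero (x y : ZMod (p ^ 2)) (hx : π x = 0) (hy : π y = 0) :
    x * y = 0 := by
  have : NeZero (p ^ 2) := ⟨pow_ne_zero _ (Fact.out : p.Prime).ne_zero⟩
  rw [← ZMod.natCast_zmod_val x, ← ZMod.natCast_zmod_val y, ← Nat.cast_mul,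
    ZMod.natCast_eq_zero_iff]
  exact (dvd_of_eq (pow_two p)).trans <| mul_dvd_mul ((castHom_eq_zero_iff x).1 hx) ((castHom_eq_zero_iff y).1 hy)

theorem exists_uniTri_lift_of_top {G : Type*} [Group G] [TopologicalSpace G]
    (hG : ∀ ρ : (⊤ : Subgroup G) →* GL (Fin 3) (ZMod p),
      IsOpen (ρ.ker : Set (⊤ : Subgroup G)) → (∀ h, IsUniTri (ρ h)) →
      ∃ τ : (⊤ : Subgroup G) →* GL (Fin 3) (ZMod (p ^ 2)), IsOpen (τ.ker : Set (⊤ : Subgroup G)) ∧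
        (∀ h, IsUniTri (τ h)) ∧ ∀ h, Matrix.GeneralLinearGroup.map π (τ h) = ρ h)
    (ρ : G →* GL (Fin 3) (ZMod p)) (hker : IsOpen (ρ.ker : Set G)) (hρ : ∀ g, IsUniTri (ρ g)) :
    ∃ ρ₂ : G →* GL (Fin 3) (ZMod (p ^ 2)), IsOpen (ρ₂.ker : Set G) ∧ (∀ g, IsUniTri (ρ₂ g)) ∧
      ∀ g, Matrix.GeneralLinearGroup.map π (ρ₂ g) = ρ g := by
  obtain ⟨τ, hτker, hτ, hτρ⟩ := hG (ρ.comp (Subgroup.subtype _))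
    (hker.preimage continuous_subtype_val) fun h => hρ h
  refine ⟨τ.comp (Subgroup.topEquiv (G := G)).symm.toMonoidHom, ?_, fun g => hτ _, fun g => hτρ _⟩
  exact hτker.preimage (continuous_id.subtype_mk fun g => Subgroup.mem_top g)

/-- If continuous homomorphisms from all open subgroups of `G` to `U_3(ZMod p)` lift to
`U_3(ZMod (p ^ 2))`, then continuous homomorphisms from `G` to `GL_3(ZMod p)` lift to
`GL_3(ZMod (p ^ 2))`. -/
theorem exists_generalLinear_lift {G : Type*} [Group G] [TopologicalSpace G] [IsTopologicalGroup G]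
    (hG : ∀ (H : Subgroup G), IsOpen (H : Set G) → ∀ ρ : H →* GL (Fin 3) (ZMod p),
      IsOpen (ρ.ker : Set H) → (∀ h, IsUniTri (ρ h)) →
      ∃ τ : H →* GL (Fin 3) (ZMod (p ^ 2)), IsOpen (τ.ker : Set H) ∧ (∀ h, IsUniTri (τ h)) ∧
        ∀ h, Matrix.GeneralLinearGroup.map π (τ h) = ρ h)
    (ρ : G →* GL (Fin 3) (ZMod p)) (hker : IsOpen (ρ.ker : Set G)) :
    ∃ ρ₂ : G →* GL (Fin 3) (ZMod (p ^ 2)), IsOpen (ρ₂.ker : Set G) ∧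
      ∀ g, Matrix.GeneralLinearGroup.map π (ρ₂ g) = ρ g := by
  have hp : p.Prime := Fact.out
  have : NeZero (p ^ 2) := ⟨pow_ne_zero _ hp.ne_zero⟩
  have hφ := Matrix.mul_eq_zero_of_map_eq_zero (n := Fin 3) π mul_eq_zero_of_castHom_eq_zero
  have hsurj := Units.map_surjective_of_sq_zero ((π).mapMatrix (m := Fin 3)) (fun N => by
    choose f hf using ZMod.castHom_surjective (n := p ^ 2) (dvd_pow_self p two_ne_zero)
    exact ⟨N.map f, Matrix.ext fun i j => hf _⟩) hφ
  obtain ⟨k, H, hmem, hindex⟩ :=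
    exists_not_dvd_index_of_not_dvd_index ρ (uniTriSubgroup (ZMod p)) (not_dvd_index_uniTriSubgroup p)
  have hle : ρ.ker ≤ H := fun g hg => by
    rw [hmem, MonoidHom.mem_ker.1 hg, mul_one, inv_mul_cancel]
    exact one_mem _
  have hH : IsOpen (H : Set G) := Subgroup.isOpen_mono hle hker
  have : H.FiniteIndex := ⟨fun h => hindex (h ▸ dvd_zero p)⟩
  let ρ' : H →* GL (Fin 3) (ZMod p) := (MulAut.conj k⁻¹).toMonoidHom.comp (ρ.comp H.subtype)
  have hρ' : ∀ h, ρ' h = k⁻¹ * ρ h * k := fun h => by simp [ρ']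
  obtain ⟨τ, hτker, -, hτ⟩ := hG H hH ρ' (by
      have h1 : (ρ'.ker : Set H) = Subtype.val ⁻¹' (ρ.ker : Set G) := by
        ext h
        simp [ρ']
      rw [h1]
      exact hker.preimage continuous_subtype_val)
    (fun h => by rw [hρ', ← mem_uniTriSubgroup, ← hmem]; exact h.2)
  obtain ⟨K, hK⟩ := hsurj k
  obtain ⟨ρ₂, hρ₂, hone⟩ := exists_lift_of_lift_subgroup (R := ZMod (p ^ 2))
    ((π).mapMatrix (m := Fin 3)) hφ hsurj H
    ((ZMod.isUnit_iff_coprime _ _).2 (((hp.coprime_iff_not_dvd).2 hindex).pow_left 2).symm) ρ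
    ((MulAut.conj K).toMonoidHom.comp τ) (fun h => by
      have h1 : Units.map ((π).mapMatrix (m := Fin 3) : _ →* _) (τ h) = k⁻¹ * ρ h * k :=
        (hτ h).trans (hρ' h)
      have h2 : (MulAut.conj K).toMonoidHom.comp τ h = K * τ h * K⁻¹ := rfl
      rw [h2, map_mul, map_mul, map_inv, hK, h1]
      group)
  refine ⟨ρ₂, ρ₂.ker.isOpen_of_mem_nhds (g := 1) ?_, hρ₂⟩
  have hN : ((τ.ker.map H.subtype : Subgroup G) : Set G) ∈ 𝓝 (1 : G) := by
    refine IsOpen.mem_nhds ?_ (one_mem _)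
    rw [Subgroup.coe_map]
    exact hH.isOpenMap_subtype_val _ hτker
  have hq : ∀ q : G ⧸ H, ∀ᶠ g in 𝓝 (1 : G), q.out⁻¹ * g * q.out ∈ τ.ker.map H.subtype := by
    intro q
    have h1 : Tendsto (fun g => q.out⁻¹ * g * q.out) (𝓝 1) (𝓝 1) := by
      have : Continuous fun g => q.out⁻¹ * g * q.out := by fun_prop
      simpa using this.tendsto 1
    exact h1 hN
  filter_upwards [eventually_all.2 hq] with g hg
  refine hone g fun q => ?_
  obtain ⟨h, hh, hh1⟩ := hg q
  refine ⟨h, hh1.symm, ?_⟩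
  rw [MonoidHom.comp_apply, MonoidHom.mem_ker.1 hh, map_one]

end Lifting

end LocalLifting

theorem stmt_12 (p : ℕ) [Fact p.Prime] (hodd : p ≠ 2)
    (l : ℕ) [Fact l.Prime]
    (F : Type) [Field F] [Algebra ℚ_[l] F] [FiniteDimensional ℚ_[l] F]
    (ζ : F) (hζ : IsPrimitiveRoot ζ (p ^ 2)) :
    (∀ ρ : AbsGal F →* GL (Fin 3) (ZMod p),
      IsOpen (ρ.ker : Set (AbsGal F)) → (∀ g, IsUniTri (ρ g)) →
      ∃ ρ₂ : AbsGal F →* GL (Fin 3) (ZMod (p ^ 2)),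
        IsOpen (ρ₂.ker : Set (AbsGal F)) ∧ (∀ g, IsUniTri (ρ₂ g)) ∧
        (Matrix.GeneralLinearGroup.map
          (ZMod.castHom (dvd_pow_self p two_ne_zero) (ZMod p))).comp ρ₂ = ρ) ∧
    (∀ ρ : AbsGal F →* GL (Fin 3) (ZMod p),
      IsOpen (ρ.ker : Set (AbsGal F)) →
      ∃ ρ₂ : AbsGal F →* GL (Fin 3) (ZMod (p ^ 2)),
        IsOpen (ρ₂.ker : Set (AbsGal F)) ∧
        (Matrix.GeneralLinearGroup.map
          (ZMod.castHom (dvd_pow_self p two_ne_zero) (ZMod p))).comp ρ₂ = ρ) := by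
  have : CharZero F := charZero_of_injective_algebraMap (algebraMap ℚ_[l] F).injective
  have : CharZero (SeparableClosure F) :=
    charZero_of_injective_algebraMap (algebraMap F (SeparableClosure F)).injective
  refine ⟨fun ρ hker hρ => ?_, fun ρ hker => ?_⟩
  · obtain ⟨ρ₂, hker₂, hρ₂, h⟩ := exists_uniTri_lift_of_top
      (exists_uniTri_lift l hodd hζ isOpen_univ) ρ hker hρ
    exact ⟨ρ₂, hker₂, hρ₂, MonoidHom.ext h⟩
  · obtain ⟨ρ₂, hker₂, h⟩ := exists_generalLinear_lift
      (fun _ hH => exists_uniTri_lift l hodd hζ hH) ρ hker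
    exact ⟨ρ₂, hker₂, MonoidHom.ext h⟩
end

section
/- Let p be a prime, q a power of p, and F = 𝔽_q((T)) the field of formal Laurent series over the finite field with q elements. Then for all integers d ≥ 1 and r ≥ 1, every continuous homomorphism Gal(F_s/F) → U_d(ℤ/p) admits a lift to a continuous homomorphism Gal(F_s/F) → U_d(ℤ/p^r) along the reduction ℤ/p^r → ℤ/p. -/
open scoped MatrixGroups

theorem exists_sum_galois_eq_one (F E : Type*) [Field F] [Field E] [Algebra F E]
    [FiniteDimensional F E] [IsGalois F E] : ∃ θ : E, ∑ σ : Gal(E/F), σ θ = 1 := by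
  obtain ⟨θ, hθ⟩ := Algebra.trace_surjective F E 1
  exact ⟨θ, by rw [← trace_eq_sum_automorphisms, hθ, map_one]⟩

/-- Finite Galois extensions have trivial additive `H²`. -/
theorem exists_additive_cochain_of_twoCocycle {F E : Type*} [Field F] [Field E] [Algebra F E]
    [FiniteDimensional F E] [IsGalois F E] (c : Gal(E/F) → Gal(E/F) → E)
    (hc : ∀ x y z, x (c y z) + c x (y * z) = c (x * y) z + c x y) :
    ∃ b : Gal(E/F) → E, ∀ x y, b x + x (b y) - b (x * y) = c x y := by
  obtain ⟨θ, hθ⟩ := exists_sum_galois_eq_one F E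
  refine ⟨fun g => ∑ x, c g x * g (x θ), fun g h => ?_⟩
  have h₁ : ∑ x, c g x * g (x θ) = ∑ x, c g (h * x) * g (h (x θ)) :=
    (Fintype.sum_equiv (Equiv.mulLeft h) _ _ fun x => by simp).symm
  have h₂ : c g h = ∑ x : Gal(E/F), c g h * g (h (x θ)) := by
    rw [← Finset.mul_sum, ← map_sum, ← map_sum, hθ, map_one, map_one, mul_one]
  simp only
  rw [h₁, h₂, map_sum, ← Finset.sum_add_distrib, ← Finset.sum_sub_distrib]
  refine Finset.sum_congr rfl fun x _ => ?_
  rw [map_mul, AlgEquiv.mul_apply]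
  linear_combination g (h (x θ)) * hc g h x

/-- The additive form of Hilbert 90 for finite Galois extensions. -/
theorem exists_eq_sub_of_additive_oneCocycle {F E : Type*} [Field F] [Field E] [Algebra F E]
    [FiniteDimensional F E] [IsGalois F E] (b : Gal(E/F) → E)
    (hb : ∀ x y, b (x * y) = b x + x (b y)) : ∃ y : E, ∀ g, b g = y - g y := by
  obtain ⟨θ, hθ⟩ := exists_sum_galois_eq_one F E
  refine ⟨∑ x, b x * x θ, fun g => ?_⟩
  have h₁ : ∑ x, b x * x θ = ∑ x, b (g * x) * g (x θ) :=
    (Fintype.sum_equiv (Equiv.mulLeft g) _ _ fun x => by simp).symm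
  have h₂ : b g = ∑ x : Gal(E/F), b g * g (x θ) := by
    rw [← Finset.mul_sum, ← map_sum, hθ, map_one, mul_one]
  nth_rewrite 1 [h₁]
  rw [h₂, map_sum, ← Finset.sum_sub_distrib]
  refine Finset.sum_congr rfl fun x _ => ?_
  rw [map_mul, hb]
  ring

theorem IsSepClosed.exists_pow_sub_self_eq {K : Type*} [Field K] [IsSepClosed K] (p : ℕ)
    [hp : Fact p.Prime] [CharP K p] (y : K) : ∃ z : K, z ^ p - z = y := by
  have hdeg : (-Polynomial.X - Polynomial.C y : Polynomial K).degree < (p : ℕ) := by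
    refine lt_of_le_of_lt (b := ((1 : ℕ) : WithBot ℕ)) ?_ (by exact_mod_cast hp.out.one_lt)
    compute_degree
    simp
  have hsub : (Polynomial.X ^ p - Polynomial.X - Polynomial.C y : Polynomial K)
      = Polynomial.X ^ p + (-Polynomial.X - Polynomial.C y) := by ring
  obtain ⟨z, hz⟩ := IsSepClosed.exists_root
    (Polynomial.X ^ p - Polynomial.X - Polynomial.C y : Polynomial K) (by
      rw [hsub, Polynomial.degree_add_eq_left_of_degree_lt (by simpa using hdeg)]
      simpa using hp.out.ne_zero) (by
      rw [Polynomial.separable_def]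
      refine ⟨0, -1, ?_⟩
      simp [Polynomial.derivative_X_pow])
  exact ⟨z, by simpa [Polynomial.IsRoot, sub_eq_zero] using hz⟩

theorem exists_zmod_castHom_eq_of_pow_eq {K : Type*} [Field K] (p : ℕ) [Fact p.Prime] [CharP K p]
    {x : K} (hx : x ^ p = x) : ∃ a : ZMod p, ZMod.castHom dvd_rfl K a = x := by
  let _ := ZMod.algebra K p
  have h := (Subfield.mem_bot_iff_pow_eq_self (F := K) (p := p)).mpr hx
  have hle : (⊥ : Subfield K) ≤ (ZMod.castHom (dvd_refl p) K).fieldRange := bot_le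
  exact hle h

section

variable {F K : Type*} [Field F] [Field K] [Algebra F K] [IsGalois F K] [IsSepClosed K]

/-- A continuous two-cocycle of the absolute Galois group of a field of characteristic `p` with
values in `ℤ/p` (with trivial action) that is inflated from a discrete quotient
is the coboundary of a locally constant cochain. -/
theorem exists_cochain_of_twoCocycle (p : ℕ) [Fact p.Prime]
    [CharP K p] {Q : Type*} [Group Q] (ρ : Gal(K/F) →* Q) (hρ : IsOpen (ρ.ker : Set Gal(K/F)))
    (c : Q → Q → ZMod p)
    (hc : ∀ x y z, c y z + c x (y * z) = c (x * y) z + c x y) :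
    ∃ (a : Gal(K/F) → ZMod p) (U : Subgroup Gal(K/F)), IsOpen (U : Set Gal(K/F)) ∧
      (∀ g h, a g + a h - a (g * h) = c (ρ g) (ρ h)) ∧ ∀ g ∈ U, a g = a 1 := by
  obtain ⟨E, hE⟩ := (InfiniteGalois.krullTopology_mem_nhds_one_iff_of_isGalois _).mp
    (hρ.mem_nhds ρ.ker.one_mem)
  let π : Gal(K/F) →* Gal(E/F) := AlgEquiv.restrictNormalHom E
  have hπ : Function.Surjective π := AlgEquiv.restrictNormalHom_surjective K
  have hπa : ∀ (g : Gal(K/F)) (x : E), ((π g x : E) : K) = g x := fun g x =>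
    AlgEquiv.restrictNormal_commutes g E x
  have hker : π.ker ≤ ρ.ker := by
    intro g hg
    refine hE ?_
    rw [SetLike.mem_coe, IntermediateField.mem_fixingSubgroup_iff]
    intro x hx
    rw [← hπa g ⟨x, hx⟩, MonoidHom.mem_ker.mp hg, AlgEquiv.one_apply]
  let σ : Gal(E/F) →* Q := MonoidHom.liftOfSurjective π hπ ⟨ρ, hker⟩
  have hσ : ∀ g, σ (π g) = ρ g := fun g =>
    MonoidHom.liftOfRightInverse_comp_apply _ _ _ ⟨ρ, hker⟩ g
  have : CharP E p := (algebraMap E K).charP (algebraMap E K).injective p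
  let ι : ZMod p →+* E := ZMod.castHom dvd_rfl E
  have hιpow : ∀ a, ι a ^ p = ι a := fun a => by rw [← map_pow, ZMod.pow_card]
  have hισ : ∀ (g : Gal(E/F)) a, g (ι a) = ι a := fun g a =>
    RingHom.congr_fun (Subsingleton.elim ((g : E →+* E).comp ι) ι) a
  obtain ⟨b, hb⟩ := exists_additive_cochain_of_twoCocycle (F := F)
    (fun x y => ι (c (σ x) (σ y))) (fun x y z => by
      simp only [hισ, map_mul, ← map_add, hc])
  obtain ⟨y, hy⟩ := exists_eq_sub_of_additive_oneCocycle (F := F)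
    (fun g => b g ^ p - b g) (fun g h => by
      have h₁ : b (g * h) = b g + g (b h) - ι (c (σ g) (σ h)) := by rw [← hb]; ring
      simp only [h₁, sub_pow_char, add_pow_char, hιpow, map_sub, map_pow]
      ring)
  obtain ⟨z, hz⟩ := IsSepClosed.exists_pow_sub_self_eq p (y : K)
  have ha : ∀ g : Gal(K/F), ∃ a : ZMod p, ZMod.castHom dvd_rfl K a = b (π g) - (z - g z) := by
    intro g
    refine exists_zmod_castHom_eq_of_pow_eq p ?_
    have h₁ := congrArg (fun x : E => (x : K)) (hy (π g))
    simp only [AddSubgroupClass.coe_sub, SubmonoidClass.coe_pow, hπa] at h₁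
    rw [← hz, map_sub, map_pow] at h₁
    rw [sub_pow_char, sub_pow_char]
    linear_combination h₁
  choose a ha using ha
  have hinj : Function.Injective (ZMod.castHom (dvd_refl p) K) := RingHom.injective _
  have hzint : IsIntegral F z := Algebra.IsIntegral.isIntegral z
  have : FiniteDimensional F (IntermediateField.adjoin F {z}) :=
    IntermediateField.adjoin.finiteDimensional hzint
  refine ⟨a, π.ker ⊓ (IntermediateField.adjoin F {z}).fixingSubgroup, ?_, fun g h => hinj ?_,
    fun g hg => hinj ?_⟩
  · have hπker : π.ker = E.fixingSubgroup := IntermediateField.restrictNormalHom_ker _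
    rw [hπker]
    exact (IntermediateField.fixingSubgroup_isOpen _).inter
      (IntermediateField.fixingSubgroup_isOpen _)
  · have h₁ := congrArg (fun x : E => (x : K)) (hb (π g) (π h))
    have h₂ : ((ι (c (ρ g) (ρ h)) : E) : K) = ZMod.castHom dvd_rfl K (c (ρ g) (ρ h)) :=
      RingHom.congr_fun (Subsingleton.elim ((algebraMap E K).comp ι) _) _
    simp only [hσ, AddSubgroupClass.coe_sub, AddMemClass.coe_add, h₂, hπa] at h₁
    have h₃ : g (ZMod.castHom dvd_rfl K (a h)) = ZMod.castHom dvd_rfl K (a h) :=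
      RingHom.congr_fun (Subsingleton.elim ((g : K →+* K).comp (ZMod.castHom dvd_rfl K)) _) _
    rw [ha, map_sub, map_sub] at h₃
    rw [← h₁, map_sub, map_add, ha, ha, ha, map_mul, AlgEquiv.mul_apply]
    linear_combination -h₃
  · have h₁ : g z = z := (IntermediateField.mem_fixingSubgroup_iff _ _).mp hg.2 z
      (IntermediateField.mem_adjoin_simple_self F z)
    rw [ha, ha, h₁, MonoidHom.mem_ker.mp hg.1, map_one, AlgEquiv.one_apply]

theorem exists_lift_of_central (p : ℕ) [Fact p.Prime] [CharP K p] {E Q : Type*} [Group E]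
    [Group Q] (f : E →* Q) (hf : Function.Surjective f) (hcard : Nat.card f.ker = p)
    (hcen : f.ker ≤ Subgroup.center E)
    (ρ : Gal(K/F) →* Q) (hρ : IsOpen (ρ.ker : Set Gal(K/F))) :
    ∃ ρ' : Gal(K/F) →* E, IsOpen (ρ'.ker : Set Gal(K/F)) ∧ f.comp ρ' = ρ := by
  let e : Multiplicative (ZMod p) ≃* f.ker := mulEquivOfPrimeCardEq (p := p) (by simp) hcard
  let ι : ZMod p → E := fun a => e (Multiplicative.ofAdd a)
  have hιadd : ∀ a b, ι (a + b) = ι a * ι b := fun a b => by simp [ι]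
  have hιinj : Function.Injective ι := fun a b h => by simpa [ι] using h
  have hιf : ∀ a, f (ι a) = 1 := fun a => (e (Multiplicative.ofAdd a)).2
  have hιcomm : ∀ a x, x * ι a = ι a * x := fun a x =>
    Subgroup.mem_center_iff.mp (hcen (e (Multiplicative.ofAdd a)).2) x
  have hιsurj : ∀ x, f x = 1 → ∃ a, ι a = x := fun x hx =>
    ⟨(e.symm ⟨x, hx⟩).toAdd, by simp [ι]⟩
  choose s hs using hf
  have hc : ∀ x y, ∃ a, ι a = s x * s y * (s (x * y))⁻¹ := fun x y =>
    hιsurj _ (by simp [hs])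
  choose c hc using hc
  have hmul : ∀ x y, s x * s y = ι (c x y) * s (x * y) := fun x y => by simp [hc]
  have hcoc : ∀ x y z, c y z + c x (y * z) = c (x * y) z + c x y := by
    refine fun x y z => hιinj (mul_right_cancel (b := s (x * y * z)) ?_)
    calc ι (c y z + c x (y * z)) * s (x * y * z)
        = ι (c y z) * (s x * s (y * z)) := by rw [hmul, hιadd, mul_assoc x, mul_assoc]
      _ = s x * (s y * s z) := by rw [hmul y z, ← mul_assoc, ← mul_assoc, hιcomm]
      _ = ι (c x y) * (s (x * y) * s z) := by rw [← mul_assoc, hmul x y, mul_assoc]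
      _ = _ := by simp only [hmul, add_comm (c (x * y) z), hιadd, mul_assoc]
  obtain ⟨a, U, hU, ha, haU⟩ := exists_cochain_of_twoCocycle p ρ hρ c hcoc
  let ρ' : Gal(K/F) →* E := MonoidHom.mk' (fun g => ι (-a g) * s (ρ g)) fun g h => by
    have h₁ : -a (g * h) = -a g + (-a h + c (ρ g) (ρ h)) := by rw [← ha]; ring
    rw [h₁, hιadd, hιadd, map_mul, mul_assoc, mul_assoc, ← hmul, mul_assoc,
      ← mul_assoc (s (ρ g)), hιcomm, mul_assoc]
  refine ⟨ρ', Subgroup.isOpen_mono (H₁ := U ⊓ ρ.ker) ?_ (hU.inter hρ), ?_⟩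
  · intro g hg
    have h₁ : ρ' g = ρ' 1 := by
      change ι (-a g) * s (ρ g) = ι (-a 1) * s (ρ 1)
      rw [haU g hg.1, MonoidHom.mem_ker.mp hg.2, map_one]
    rw [MonoidHom.mem_ker, h₁, map_one]
  · ext g
    change f (ι (-a g) * s (ρ g)) = ρ g
    rw [map_mul, hιf, hs, one_mul]

theorem IsPGroup.exists_mem_center_of_normal {p : ℕ} [Fact p.Prime] {E : Type*} [Group E]
    [Finite E] (hE : IsPGroup p E) (N : Subgroup E) [N.Normal] (hN : N ≠ ⊥) :
    ∃ z ∈ N, z ∈ Subgroup.center E ∧ orderOf z = p := by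
  have hdvd : p ∣ Nat.card N := (hE.to_subgroup N).card_eq_or_dvd.resolve_left fun h =>
    hN (Subgroup.card_eq_one.mp h)
  obtain ⟨b, hb, hb1⟩ :=
    (hE.of_equiv ConjAct.toConjAct).exists_fixed_point_of_prime_dvd_card_of_fixed_point
      N hdvd (a := 1) (fun g => by simp)
  have hM : N ⊓ Subgroup.center E ≠ ⊥ := by
    intro h
    have hmem : (b : E) ∈ N ⊓ Subgroup.center E := by
      refine ⟨b.2, Subgroup.mem_center_iff.mpr fun g => ?_⟩
      have := congrArg (fun x : N => (x : E)) (hb (ConjAct.toConjAct g))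
      simp only [ConjAct.Subgroup.val_conj_smul, ConjAct.smul_def,
        ConjAct.ofConjAct_toConjAct] at this
      exact mul_inv_eq_iff_eq_mul.mp this
    rw [h, Subgroup.mem_bot] at hmem
    exact hb1 (Subtype.ext hmem.symm)
  have hdvd' : p ∣ Nat.card ↥(N ⊓ Subgroup.center E) :=
    (hE.to_subgroup _).card_eq_or_dvd.resolve_left fun h => hM (Subgroup.card_eq_one.mp h)
  obtain ⟨z, hz⟩ := exists_prime_orderOf_dvd_card' p hdvd'
  exact ⟨z, z.2.1, z.2.2, by rw [Subgroup.orderOf_coe, hz]⟩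

/-- Over a field of characteristic `p`, every embedding problem for finite `p`-groups has a
(not necessarily surjective) solution. -/
theorem exists_lift_of_isPGroup (p : ℕ) [Fact p.Prime] [CharP K p] {E Q : Type*} [Group E]
    [Finite E] [Group Q] (hE : IsPGroup p E) (f : E →* Q) (hf : Function.Surjective f)
    (ρ : Gal(K/F) →* Q) (hρ : IsOpen (ρ.ker : Set Gal(K/F))) :
    ∃ ρ' : Gal(K/F) →* E, IsOpen (ρ'.ker : Set Gal(K/F)) ∧ f.comp ρ' = ρ := by
  induction hn : Nat.card E using Nat.strong_induction_on generalizing E with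
  | _ n ih =>
  by_cases hker : f.ker = ⊥
  · let e := MulEquiv.ofBijective f ⟨(MonoidHom.ker_eq_bot_iff f).mp hker, hf⟩
    refine ⟨e.symm.toMonoidHom.comp ρ, ?_, ?_⟩
    · rwa [show (e.symm.toMonoidHom.comp ρ).ker = ρ.ker from
        MonoidHom.ker_comp_of_injective ρ _ e.symm.injective]
    · ext g
      exact e.apply_symm_apply (ρ g)
  · obtain ⟨z, hzN, hzc, hz⟩ := hE.exists_mem_center_of_normal f.ker hker
    have hcen : Subgroup.zpowers z ≤ Subgroup.center E := by simpa using hzc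
    have hle : Subgroup.zpowers z ≤ f.ker := by simpa using hzN
    have hcardz : Nat.card (Subgroup.zpowers z) = p := by rw [Nat.card_zpowers, hz]
    have : (Subgroup.zpowers z).Normal :=
      ⟨fun x hx g => by rwa [Subgroup.mem_center_iff.mp (hcen hx) g, mul_inv_cancel_right]⟩
    have hlt : Nat.card (E ⧸ Subgroup.zpowers z) < n := by
      have h₁ := Subgroup.card_eq_card_quotient_mul_card_subgroup (Subgroup.zpowers z)
      rw [hcardz, hn] at h₁
      rw [h₁]
      exact lt_mul_of_one_lt_right Nat.card_pos (Fact.out : p.Prime).one_lt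
    obtain ⟨ρ₁, hρ₁, hcomp₁⟩ := ih _ hlt (hE.to_quotient _) (QuotientGroup.lift _ f hle)
      (QuotientGroup.lift_surjective_of_surjective _ f hf hle) rfl
    obtain ⟨ρ₂, hρ₂, hcomp₂⟩ := exists_lift_of_central p (QuotientGroup.mk' (Subgroup.zpowers z))
      (QuotientGroup.mk'_surjective _) (by rw [QuotientGroup.ker_mk', hcardz])
      (by rwa [QuotientGroup.ker_mk']) ρ₁ hρ₁
    refine ⟨ρ₂, hρ₂, ?_⟩
    rw [← hcomp₁, ← hcomp₂]
    rfl

end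

theorem IsUpperTri.mul {d : ℕ} {R : Type} [CommRing R] {g h : GL (Fin d) R} (hg : IsUpperTri g)
    (hh : IsUpperTri h) : IsUpperTri (g * h) := fun _ _ hij =>
  Matrix.BlockTriangular.mul (b := id) (fun _ _ h => hg _ _ h) (fun _ _ h => hh _ _ h) hij

theorem IsUniTri.mul {d : ℕ} {R : Type} [CommRing R] {g h : GL (Fin d) R} (hg : IsUniTri g)
    (hh : IsUniTri h) : IsUniTri (g * h) := by
  refine ⟨hg.1.mul hh.1, fun i => ?_⟩
  rw [Units.val_mul, Matrix.mul_apply, Finset.sum_eq_single i, hg.2, hh.2, one_mul]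
  · intro j _ hj
    rcases lt_or_gt_of_ne hj with h | h
    · rw [hg.1 i j h, zero_mul]
    · rw [hh.1 j i h, mul_zero]
  · simp

theorem isUniTri_one {d : ℕ} {R : Type} [CommRing R] : IsUniTri (1 : GL (Fin d) R) :=
  ⟨fun i j h => by simp [h.ne'], fun i => by simp⟩

theorem IsUniTri.pow {d : ℕ} {R : Type} [CommRing R] {g : GL (Fin d) R} (hg : IsUniTri g) (k : ℕ) :
    IsUniTri (g ^ k) := by
  induction k with
  | zero => simpa using isUniTri_one
  | succ k ih => exact pow_succ g k ▸ ih.mul hg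

/-- The group `U_d(R)` of upper unitriangular matrices over a finite ring `R`. -/
def uniTri (d : ℕ) (R : Type) [CommRing R] [Finite R] : Subgroup (GL (Fin d) R) where
  carrier := {g | IsUniTri g}
  mul_mem' := IsUniTri.mul
  one_mem' := isUniTri_one
  inv_mem' {g} hg := by
    obtain ⟨k, hk⟩ := (mem_powers_iff_mem_zpowers (x := g)).mpr (inv_mem (Subgroup.mem_zpowers g))
    exact hk ▸ IsUniTri.pow hg k

/-- The matrix with ones on the diagonal and prescribed entries above the diagonal. -/
def uniTriMatrix {d : ℕ} {R : Type} [CommRing R] (a : {x : Fin d × Fin d // x.1 < x.2} → R) :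
    Matrix (Fin d) (Fin d) R :=
  Matrix.of fun i j => if h : i < j then a ⟨(i, j), h⟩ else if i = j then 1 else 0

theorem det_uniTriMatrix {d : ℕ} {R : Type} [CommRing R]
    (a : {x : Fin d × Fin d // x.1 < x.2} → R) : (uniTriMatrix a).det = 1 := by
  rw [Matrix.det_of_isUpperTriangular]
  · simp [uniTriMatrix]
  · intro i j h
    have h : j < i := h
    simp [uniTriMatrix, h.not_gt, h.ne']

theorem isUniTri_mk_uniTriMatrix {d : ℕ} {R : Type} [CommRing R]
    (a : {x : Fin d × Fin d // x.1 < x.2} → R) :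
    IsUniTri (Matrix.GeneralLinearGroup.mk'' (uniTriMatrix a)
      (by rw [det_uniTriMatrix]; exact isUnit_one)) := by
  refine ⟨fun i j h => ?_, fun i => ?_⟩
  · change uniTriMatrix a i j = 0
    simp [uniTriMatrix, h.not_gt, h.ne']
  · change uniTriMatrix a i i = 1
    simp [uniTriMatrix]

theorem IsUniTri.ext {d : ℕ} {R : Type} [CommRing R] {g h : GL (Fin d) R} (hg : IsUniTri g)
    (hh : IsUniTri h) (H : ∀ i j, i < j → g i j = h i j) : g = h := by
  refine Matrix.GeneralLinearGroup.ext fun i j => ?_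
  rcases lt_trichotomy i j with hij | rfl | hij
  · exact H i j hij
  · rw [hg.2, hh.2]
  · rw [hg.1 i j hij, hh.1 i j hij]

/-- Unitriangular matrices are determined by their entries above the diagonal. -/
noncomputable def uniTriEquiv (d : ℕ) (R : Type) [CommRing R] [Finite R] :
    uniTri d R ≃ ({x : Fin d × Fin d // x.1 < x.2} → R) where
  toFun g x := (g : GL (Fin d) R) x.1.1 x.1.2
  invFun a := ⟨_, isUniTri_mk_uniTriMatrix a⟩
  left_inv g := Subtype.ext <| (isUniTri_mk_uniTriMatrix _).ext g.2 fun i j h => by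
    change uniTriMatrix (fun x => (g : GL (Fin d) R) x.1.1 x.1.2) i j = _
    simp [uniTriMatrix, h]
  right_inv a := by
    ext ⟨⟨i, j⟩, h⟩
    change uniTriMatrix a i j = _
    simp [uniTriMatrix, show i < j from h]

theorem isPGroup_uniTri (p d r : ℕ) [NeZero (p ^ r)] : IsPGroup p (uniTri d (ZMod (p ^ r))) := by
  refine IsPGroup.of_card (n := r * Nat.card {x : Fin d × Fin d // x.1 < x.2}) ?_
  rw [Nat.card_congr (uniTriEquiv d _), Nat.card_fun, Nat.card_zmod, pow_mul]

theorem IsUniTri.map {d : ℕ} {R S : Type} [CommRing R] [CommRing S] (f : R →+* S)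
    {g : GL (Fin d) R} (hg : IsUniTri g) : IsUniTri (Matrix.GeneralLinearGroup.map f g) :=
  ⟨fun i j h => by simp [hg.1 i j h], fun i => by simp [hg.2 i]⟩

/-- Entrywise application of a ring homomorphism to unitriangular matrices. -/
noncomputable def uniTriMap {d : ℕ} {R S : Type} [CommRing R] [Finite R] [CommRing S] [Finite S]
    (f : R →+* S) : uniTri d R →* uniTri d S :=
  ((Matrix.GeneralLinearGroup.map f).comp (uniTri d R).subtype).codRestrict _
    fun g => IsUniTri.map f g.2

theorem uniTriMap_surjective {d : ℕ} {R S : Type} [CommRing R] [Finite R] [CommRing S] [Finite S]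
    (f : R →+* S) (hf : Function.Surjective f) : Function.Surjective (uniTriMap (d := d) f) := by
  intro g
  choose s hs using hf
  let g' := (uniTriEquiv d R).symm fun x => s ((g : GL (Fin d) S) x.1.1 x.1.2)
  refine ⟨g', Subtype.ext <| (IsUniTri.map f g'.2).ext g.2 fun i j h => ?_⟩
  have h₁ := congrFun ((uniTriEquiv d R).apply_symm_apply
    fun x => s ((g : GL (Fin d) S) x.1.1 x.1.2)) ⟨(i, j), h⟩
  change f (g'.1 i j) = _
  exact (congrArg f h₁).trans (hs _)

theorem stmt_17 (p n : ℕ) [Fact p.Prime] (hn : 1 ≤ n)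
    (d r : ℕ) (hd : 1 ≤ d) (hr : 1 ≤ r)
    (ρ : AbsGal (LaurentSeries (GaloisField p n)) →* GL (Fin d) (ZMod p))
    (hcont : IsOpen (ρ.ker : Set (AbsGal (LaurentSeries (GaloisField p n)))))
    (htri : ∀ g, IsUniTri (ρ g)) :
    ∃ ρ₂ : AbsGal (LaurentSeries (GaloisField p n)) →* GL (Fin d) (ZMod (p ^ r)),
      IsOpen (ρ₂.ker : Set (AbsGal (LaurentSeries (GaloisField p n)))) ∧
      (∀ g, IsUniTri (ρ₂ g)) ∧
      (Matrix.GeneralLinearGroup.map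
        (ZMod.castHom (dvd_pow_self p (Nat.one_le_iff_ne_zero.mp hr)) (ZMod p))).comp ρ₂
        = ρ := by
  have : CharP (LaurentSeries (GaloisField p n)) p :=
    charP_of_injective_algebraMap (algebraMap (GaloisField p n) _).injective p
  have : CharP (SeparableClosure (LaurentSeries (GaloisField p n))) p :=
    charP_of_injective_algebraMap (algebraMap (LaurentSeries (GaloisField p n)) _).injective p
  let ρ₀ : AbsGal (LaurentSeries (GaloisField p n)) →* uniTri d (ZMod p) := ρ.codRestrict _ htri
  obtain ⟨ρ₁, hρ₁, hcomp⟩ := exists_lift_of_isPGroup p (isPGroup_uniTri p d r)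
    (uniTriMap (ZMod.castHom (dvd_pow_self p (Nat.one_le_iff_ne_zero.mp hr)) (ZMod p)))
    (uniTriMap_surjective _ (ZMod.castHom_surjective _)) ρ₀
    (by rwa [show ρ₀.ker = ρ.ker from MonoidHom.ker_codRestrict ρ _ htri])
  refine ⟨(uniTri d _).subtype.comp ρ₁, ?_, fun g => (ρ₁ g).2, ?_⟩
  · rwa [MonoidHom.ker_comp_of_injective _ _ (Subgroup.subtype_injective _)]
  · exact congrArg (uniTri d (ZMod p)).subtype.comp hcomp
end
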